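/- arXiv:1406.7590 — 4 statements merged into one kernel-verified Lean document; each statement's English description precedes it below -/
import Mathlib

section
/- Let S be a Noetherian commutative ring, let I and J be ideals of S, and let M be an S-module. Then there is a long exact Mayer–Vietoris sequence 0 → H^0_{I+J}(M) → H^0_I(M) ⊕ H^0_J(M) → H^0_{I∩J}(M) → H^1_{I+J}(M) → H^1_I(M) ⊕ H^1_J(M) → H^1_{I∩J}(M) → ⋯, functorial in M. -/
open CategoryTheory

namespace LCMV
open Limits Opposite

variable {S : Type} [CommRing S]

noncomputable abbrev FY (Y : ModuleCat.{0} S) : ModuleCat.{0} S ⥤ (ModuleCat.{0} S)ᵒᵖ :=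
  ((linearYoneda S (ModuleCat.{0} S)).obj Y).rightOp

/-- The dual complex of the chosen resolution -/
noncomputable abbrev LC (X Y : ModuleCat.{0} S) : ChainComplex (ModuleCat.{0} S)ᵒᵖ ℕ :=
  ((FY Y).mapHomologicalComplex _).obj (projectiveResolution X).complex

noncomputable abbrev OE (n : ℕ) (X Y : ModuleCat.{0} S) : ModuleCat.{0} S :=
  ((Ext S (ModuleCat.{0} S) n).obj (op X)).obj Y

noncomputable abbrev Z (n : ℕ) (X Y : ModuleCat.{0} S) : ModuleCat.{0} S :=
  unop ((LC X Y).opcycles n)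

noncomputable def isoE (n : ℕ) (X Y : ModuleCat.{0} S) :
    OE n X Y ≅ unop ((LC X Y).homology n) :=
  ((projectiveResolution X).isoLeftDerivedObj (FY Y) n).unop.symm

noncomputable def zπ (n : ℕ) (X Y : ModuleCat.{0} S) : Z n X Y ⟶ OE n X Y :=
  ((LC X Y).homologyι n).unop ≫ (isoE n X Y).inv

noncomputable def zi (n : ℕ) (X Y : ModuleCat.{0} S) :
    Z n X Y ⟶ ModuleCat.of S ((projectiveResolution X).complex.X n ⟶ Y) :=
  ((LC X Y).pOpcycles n).unop

instance (n : ℕ) (X Y : ModuleCat.{0} S) : Mono (zi n X Y) :=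
  unop_mono_of_epi ((LC X Y).pOpcycles n)

instance (n : ℕ) (X Y : ModuleCat.{0} S) : Epi (zπ n X Y) := by
  unfold zπ; infer_instance

lemma d_zi (n m : ℕ) (X Y : ModuleCat.{0} S) (z : Z n X Y) :
    (projectiveResolution X).complex.d m n ≫ zi n X Y z = 0 := by
  have h := congrArg Quiver.Hom.unop ((LC X Y).d_pOpcycles m n)
  exact congrArg (fun f => f.hom z) h

lemma exists_zi (n : ℕ) (X Y : ModuleCat.{0} S)
    (f : (projectiveResolution X).complex.X n ⟶ Y)
    (hf : (projectiveResolution X).complex.d (n+1) n ≫ f = 0) :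
    ∃ z, zi n X Y z = f := by
  have h := (LC X Y).opcyclesIsCokernel (n+1) n (by simp)
  have h2 := (ShortComplex.exact_of_g_is_cokernel
    (ShortComplex.mk _ _ ((LC X Y).d_pOpcycles (n+1) n)) h).unop
  rw [ShortComplex.moduleCat_exact_iff] at h2
  exact h2 f hf

lemma zπ_eq_zero_iff (n : ℕ) (X Y : ModuleCat.{0} S) (z : Z n X Y) :
    zπ n X Y z = 0 ↔ ∃ g : (projectiveResolution X).complex.X ((ComplexShape.down ℕ).next n) ⟶ Y,
      (projectiveResolution X).complex.d n ((ComplexShape.down ℕ).next n) ≫ g = zi n X Y z := by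
  have h := (LC X Y).homologyIsKernel n _ rfl
  have h2 := (ShortComplex.exact_of_f_is_kernel
    (ShortComplex.mk _ _ ((LC X Y).homologyι_comp_fromOpcycles n _)) h).unop
  rw [ShortComplex.moduleCat_exact_iff] at h2
  have key : ∀ g : (projectiveResolution X).complex.X ((ComplexShape.down ℕ).next n) ⟶ Y,
      zi n X Y (((LC X Y).fromOpcycles n ((ComplexShape.down ℕ).next n)).unop.hom g) =
      (projectiveResolution X).complex.d n ((ComplexShape.down ℕ).next n) ≫ g := by
    intro g
    have h := congrArg Quiver.Hom.unop ((LC X Y).p_fromOpcycles n ((ComplexShape.down ℕ).next n))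
    exact congrArg (fun f => f.hom g) h
  have inj : Function.Injective (zi n X Y) := (ModuleCat.mono_iff_injective _).1 inferInstance
  constructor
  · intro hz
    have hz' : ((LC X Y).homologyι n).unop.hom z = 0 := by
      have := congrArg (isoE n X Y).hom.hom hz
      simpa [zπ] using this
    obtain ⟨g, hg⟩ := h2 z hz'
    exact ⟨g, (key g).symm.trans (congrArg _ hg)⟩
  · rintro ⟨g, hg⟩
    rw [← key] at hg
    have := inj hg
    rw [← this]
    have h := congrArg Quiver.Hom.unop ((LC X Y).homologyι_comp_fromOpcycles n
      ((ComplexShape.down ℕ).next n))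
    have h3 := congrArg (fun f => f.hom g) h
    change (isoE n X Y).inv.hom _ = 0
    erw [h3]
    exact map_zero _

/-- functoriality -/
lemma zπ_natX (n : ℕ) {X X' : ModuleCat.{0} S} (g : X' ⟶ X) (Y : ModuleCat.{0} S)
    (φ : ProjectiveResolution.Hom (projectiveResolution X') (projectiveResolution X) g)
    (z : Z n X Y) :
    ∃ z' : Z n X' Y, zi n X' Y z' = φ.hom.f n ≫ zi n X Y z ∧
      zπ n X' Y z' = (((Ext S (ModuleCat.{0} S) n).map g.op).app Y) (zπ n X Y z) := by
  let ψ := ((FY Y).mapHomologicalComplex (ComplexShape.down ℕ)).map φ.hom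
  have h1 := congrArg Quiver.Hom.unop (HomologicalComplex.p_opcyclesMap ψ n)
  have h2 := congrArg Quiver.Hom.unop (HomologicalComplex.homologyι_naturality ψ n)
  have h3 := congrArg Quiver.Hom.unop (ProjectiveResolution.isoLeftDerivedObj_hom_naturality g
    _ _ φ.hom (by simpa using φ.hom_f_zero_comp_π_f_zero) (FY Y) n)
  refine ⟨(HomologicalComplex.opcyclesMap ψ n).unop.hom z, ?_, ?_⟩
  · exact congrArg (fun f => f.hom z) h1
  · have h4 : (HomologicalComplex.opcyclesMap ψ n).unop ≫ zπ n X' Y =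
      zπ n X Y ≫ (((Ext S (ModuleCat.{0} S) n).map g.op).app Y) := by
      unfold zπ
      have h2' : ((LC X Y).homologyι n).unop ≫ (HomologicalComplex.homologyMap ψ n).unop =
        (HomologicalComplex.opcyclesMap ψ n).unop ≫ ((LC X' Y).homologyι n).unop := h2
      have h3' : (isoE n X Y).inv ≫ (((Ext S (ModuleCat.{0} S) n).map g.op).app Y) =
         (HomologicalComplex.homologyMap ψ n).unop ≫ (isoE n X' Y).inv := h3
      rw [← Category.assoc, ← h2', Category.assoc, Category.assoc, h3']
    exact congrArg (fun f => f.hom z) h4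

lemma zπ_natY (n : ℕ) {Y Y' : ModuleCat.{0} S} (X : ModuleCat.{0} S) (g : Y ⟶ Y')
    (z : Z n X Y) :
    ∃ z' : Z n X Y', zi n X Y' z' = zi n X Y z ≫ g ∧
      zπ n X Y' z' = (((Ext S (ModuleCat.{0} S) n).obj (op X)).map g) (zπ n X Y z) := by
  let α : FY Y' ⟶ FY Y := ((linearYoneda S (ModuleCat.{0} S)).map g).rightOp
  let ψ := (NatTrans.mapHomologicalComplex α (ComplexShape.down ℕ)).app
    (projectiveResolution X).complex
  have h1 := congrArg Quiver.Hom.unop (HomologicalComplex.p_opcyclesMap ψ n)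
  have h2 := congrArg Quiver.Hom.unop (HomologicalComplex.homologyι_naturality ψ n)
  have h3 := congrArg Quiver.Hom.unop ((projectiveResolution X).leftDerived_app_eq α n)
  refine ⟨(HomologicalComplex.opcyclesMap ψ n).unop.hom z, ?_, ?_⟩
  · exact congrArg (fun f => f.hom z) h1
  · have h4 : (HomologicalComplex.opcyclesMap ψ n).unop ≫ zπ n X Y' =
      zπ n X Y ≫ (((Ext S (ModuleCat.{0} S) n).obj (op X)).map g) := by
      unfold zπ
      have h2' : ((LC X Y).homologyι n).unop ≫ (HomologicalComplex.homologyMap ψ n).unop =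
        (HomologicalComplex.opcyclesMap ψ n).unop ≫ ((LC X Y').homologyι n).unop := h2
      have h3' : (((Ext S (ModuleCat.{0} S) n).obj (op X)).map g) =
         ((isoE n X Y).hom ≫ (HomologicalComplex.homologyMap ψ n).unop) ≫ (isoE n X Y').inv := h3
      rw [← Category.assoc, ← h2', Category.assoc, Category.assoc, h3']
      simp
    exact congrArg (fun f => f.hom z) h4


lemma extMk_eq_zero_iff_next {X Y : ModuleCat.{0} S} (R : ProjectiveResolution X) (n : ℕ)
    (f : R.complex.X n ⟶ Y) (hf : R.complex.d (n+1) n ≫ f = 0) :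
    R.extMk f (n+1) rfl hf = 0 ↔ ∃ g : R.complex.X ((ComplexShape.down ℕ).next n) ⟶ Y,
      R.complex.d n ((ComplexShape.down ℕ).next n) ≫ g = f := by
  cases n with
  | succ p =>
    have : (ComplexShape.down ℕ).next (p+1) = p := by simp
    rw [this]
    exact R.extMk_eq_zero_iff f _ rfl hf p rfl
  | zero =>
    have : R.complex.d 0 ((ComplexShape.down ℕ).next 0) = 0 :=
      R.complex.shape _ _ (by simp)
    rw [this]
    simp only [zero_comp, exists_const]
    constructor
    · intro h
      simp only [← R.extEquivCohomologyClass.apply_eq_iff_eq,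
        ProjectiveResolution.extEquivCohomologyClass_extMk,
        ProjectiveResolution.extEquivCohomologyClass_zero,
        CochainComplex.HomComplex.CohomologyClass.mk_eq_zero_iff] at h
      rw [CochainComplex.HomComplex.Cocycle.toSingleMk_mem_coboundaries_iff _ _ _ _ _ 1 (by simp)]
        at h
      obtain ⟨g, hg⟩ := h
      have hz : g = 0 := (R.cochainComplex.isZero_of_isStrictlyLE 0 1).eq_of_src _ _
      rw [hz, comp_zero] at hg
      rw [← cancel_epi (R.cochainComplexXIso (-(0:ℕ)) 0 rfl).hom]
      rw [comp_zero]
      exact hg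
    · rintro rfl
      simp

/-- The map from cocycles to the derived category `Ext`. -/
noncomputable def zb (n : ℕ) (X Y : ModuleCat.{0} S) : Z n X Y →ₗ[S] Abelian.Ext X Y n where
  toFun z := (projectiveResolution X).extMk (zi n X Y z) (n+1) rfl (d_zi n (n+1) X Y z)
  map_add' z z' := by
    rw [ProjectiveResolution.add_extMk]
    congr 1
    exact map_add (zi n X Y).hom z z'
  map_smul' s z := by
    rw [RingHom.id_apply, Abelian.Ext.smul_eq_comp_mk₀, ProjectiveResolution.extMk_comp_mk₀]
    congr 1
    refine (map_smul (zi n X Y).hom s z).trans ?_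
    rw [Linear.comp_smul, Category.comp_id]

lemma zb_surj (n : ℕ) (X Y : ModuleCat.{0} S) : Function.Surjective (zb n X Y) := by
  intro e
  obtain ⟨f, hf, rfl⟩ := (projectiveResolution X).extMk_surjective e (n+1) rfl
  obtain ⟨z, rfl⟩ := exists_zi n X Y f hf
  exact ⟨z, rfl⟩

lemma zπ_surj (n : ℕ) (X Y : ModuleCat.{0} S) : Function.Surjective (zπ n X Y).hom :=
  (ModuleCat.epi_iff_surjective _).1 inferInstance

lemma ker_eq (n : ℕ) (X Y : ModuleCat.{0} S) :
    LinearMap.ker (zπ n X Y).hom = LinearMap.ker (zb n X Y) := by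
  ext z
  rw [LinearMap.mem_ker, LinearMap.mem_ker]
  exact (zπ_eq_zero_iff n X Y z).trans (extMk_eq_zero_iff_next _ _ _ (d_zi n (n+1) X Y z)).symm

noncomputable def cmp (n : ℕ) (X Y : ModuleCat.{0} S) : OE n X Y ≃ₗ[S] Abelian.Ext X Y n :=
  ((zπ n X Y).hom.quotKerEquivOfSurjective (zπ_surj n X Y)).symm ≪≫ₗ
    Submodule.quotEquivOfEq _ _ (ker_eq n X Y) ≪≫ₗ
      (zb n X Y).quotKerEquivOfSurjective (zb_surj n X Y)

lemma cmp_zπ (n : ℕ) (X Y : ModuleCat.{0} S) (z : Z n X Y) :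
    cmp n X Y ((zπ n X Y) z) = zb n X Y z := by
  have h : ((zπ n X Y).hom.quotKerEquivOfSurjective (zπ_surj n X Y)).symm ((zπ n X Y) z) =
      Submodule.Quotient.mk z := by
    rw [LinearEquiv.symm_apply_eq]; rfl
  simp only [cmp, LinearEquiv.trans_apply]
  erw [h]
  rfl

lemma cmp_natX (n : ℕ) {X X' : ModuleCat.{0} S} (g : X' ⟶ X) (Y : ModuleCat.{0} S)
    (x : OE n X Y) :
    cmp n X' Y (((Ext S (ModuleCat.{0} S) n).map g.op).app Y x) =
      (Abelian.Ext.mk₀ g).comp (cmp n X Y x) (zero_add n) := by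
  obtain ⟨z, rfl⟩ := zπ_surj n X Y x
  let φ : ProjectiveResolution.Hom (projectiveResolution X') (projectiveResolution X) g :=
    { hom := ProjectiveResolution.lift g _ _
      hom_f_zero_comp_π_f_zero := by
        simpa using ProjectiveResolution.lift_commutes_zero g
          (projectiveResolution X') (projectiveResolution X) }
  obtain ⟨z', h1, h2⟩ := zπ_natX n g Y φ z
  refine (congrArg (cmp n X' Y) h2.symm).trans ?_
  rw [cmp_zπ]
  refine Eq.trans ?_ (congrArg (fun t => (Abelian.Ext.mk₀ g).comp t (zero_add n))
    (cmp_zπ n X Y z).symm)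
  refine Eq.trans ?_ (ProjectiveResolution.mk₀_comp_extMk (zi n X Y z) (n+1) rfl
    (d_zi n (n+1) X Y z) φ).symm
  change ProjectiveResolution.extMk _ _ _ rfl (d_zi n (n+1) X' Y z') = _
  congr 1

lemma cmp_natY (n : ℕ) {Y Y' : ModuleCat.{0} S} (X : ModuleCat.{0} S) (g : Y ⟶ Y')
    (x : OE n X Y) :
    cmp n X Y' (((Ext S (ModuleCat.{0} S) n).obj (op X)).map g x) =
      (cmp n X Y x).comp (Abelian.Ext.mk₀ g) (add_zero n) := by
  obtain ⟨z, rfl⟩ := zπ_surj n X Y x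
  obtain ⟨z', h1, h2⟩ := zπ_natY n X g z
  refine (congrArg (cmp n X Y') h2.symm).trans ?_
  rw [cmp_zπ]
  refine Eq.trans ?_ (congrArg (fun t => Abelian.Ext.comp t (Abelian.Ext.mk₀ g) (add_zero n))
    (cmp_zπ n X Y z).symm)
  refine Eq.trans ?_ (ProjectiveResolution.extMk_comp_mk₀ _ (zi n X Y z) (n+1) rfl
    (d_zi n (n+1) X Y z) g).symm
  change ProjectiveResolution.extMk _ _ _ rfl (d_zi n (n+1) X Y' z') = _
  congr 1

section delta
variable {T : ShortComplex (ModuleCat.{0} S)} (hT : T.ShortExact)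

noncomputable def dl (n : ℕ) (Y : ModuleCat.{0} S) : OE n T.X₁ Y →ₗ[S] OE (n+1) T.X₃ Y :=
  (cmp (n+1) T.X₃ Y).symm.toLinearMap ∘ₗ
    (Abelian.Ext.bilinearCompOfLinear S T.X₃ T.X₁ Y 1 n (n+1) (add_comm 1 n) hT.extClass) ∘ₗ
      (cmp n T.X₁ Y).toLinearMap

lemma cmp_dl (n : ℕ) (Y : ModuleCat.{0} S) (x : OE n T.X₁ Y) :
    cmp (n+1) T.X₃ Y (dl hT n Y x) =
      hT.extClass.comp (cmp n T.X₁ Y x) (add_comm 1 n) := by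
  simp only [dl, LinearMap.comp_apply, LinearEquiv.coe_coe, LinearEquiv.apply_symm_apply]
  rfl

noncomputable def dlN (n : ℕ) : (Ext S (ModuleCat.{0} S) n).obj (op T.X₁) ⟶
    (Ext S (ModuleCat.{0} S) (n+1)).obj (op T.X₃) where
  app Y := ModuleCat.ofHom (dl hT n Y)
  naturality Y Y' g := by
    ext x
    apply (cmp (n+1) T.X₃ Y').injective
    change cmp (n+1) T.X₃ Y' (dl hT n Y' (((Ext S (ModuleCat.{0} S) n).obj (op T.X₁)).map g x)) =
      cmp (n+1) T.X₃ Y' (((Ext S (ModuleCat.{0} S) (n+1)).obj (op T.X₃)).map g (dl hT n Y x))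
    rw [cmp_natY, cmp_dl, cmp_dl, cmp_natY]
    rw [Abelian.Ext.comp_assoc]
    all_goals lia

lemma dlN_natural {T' : ShortComplex (ModuleCat.{0} S)} (hT' : T'.ShortExact) (f : T ⟶ T')
    (n : ℕ) :
    (Ext S (ModuleCat.{0} S) n).map f.τ₁.op ≫ dlN hT n =
      dlN hT' n ≫ (Ext S (ModuleCat.{0} S) (n+1)).map f.τ₃.op := by
  ext Y x
  apply (cmp (n+1) T.X₃ Y).injective
  change cmp (n+1) T.X₃ Y (dl hT n Y (((Ext S (ModuleCat.{0} S) n).map f.τ₁.op).app Y x)) =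
      cmp (n+1) T.X₃ Y (((Ext S (ModuleCat.{0} S) (n+1)).map f.τ₃.op).app Y (dl hT' n Y x))
  rw [cmp_natX, cmp_dl, cmp_dl, cmp_natX]
  rw [← Abelian.Ext.comp_assoc _ _ _ (add_zero 1) (zero_add n) (by lia),
    ShortComplex.ShortExact.extClass_naturality hT hT' f,
    ← Abelian.Ext.comp_assoc _ _ _ (zero_add 1) (by lia) (by lia)]

end delta

lemma comp_sub' {X Y W : ModuleCat.{0} S} {n m p : ℕ} (α : Abelian.Ext X Y n)
    (β₁ β₂ : Abelian.Ext Y W m) (h : n + m = p) :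
    α.comp (β₁ - β₂) h = α.comp β₁ h - α.comp β₂ h := by
  rw [sub_eq_add_neg, Abelian.Ext.comp_add, Abelian.Ext.comp_neg, sub_eq_add_neg]

section MV
variable (A B : Ideal S)

noncomputable abbrev Q (A : Ideal S) : ModuleCat.{0} S := ModuleCat.of S (S ⧸ A)

noncomputable abbrev qm {A B : Ideal S} (h : A ≤ B) : Q A ⟶ Q B :=
  ModuleCat.ofHom (Submodule.mapQ A B LinearMap.id h)

noncomputable abbrev mvf : Q (A ⊓ B) ⟶ ModuleCat.of S ((S ⧸ A) × (S ⧸ B)) :=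
  ModuleCat.ofHom ((Submodule.mapQ (A ⊓ B) A LinearMap.id inf_le_left).prod
    (Submodule.mapQ (A ⊓ B) B LinearMap.id inf_le_right))

noncomputable abbrev mvg : ModuleCat.of S ((S ⧸ A) × (S ⧸ B)) ⟶ Q (A ⊔ B) :=
  ModuleCat.ofHom ((Submodule.mapQ A (A ⊔ B) LinearMap.id le_sup_left).coprod
    (-(Submodule.mapQ B (A ⊔ B) LinearMap.id le_sup_right)))

noncomputable abbrev mvT : ShortComplex (ModuleCat.{0} S) :=
  ShortComplex.mk (mvf A B) (mvg A B) (by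
    ext x
    simp)

lemma mvT_exact : (mvT A B).ShortExact := by
  have h1 : Mono (mvf A B) := by
    rw [ModuleCat.mono_iff_injective]
    refine (injective_iff_map_eq_zero (mvf A B).hom).2 ?_
    intro x hx
    obtain ⟨x, rfl⟩ := Submodule.Quotient.mk_surjective _ x
    have hx' : ((Submodule.Quotient.mk x : S ⧸ A), (Submodule.Quotient.mk x : S ⧸ B)) = (0, 0) := hx
    rw [Prod.mk.injEq, Submodule.Quotient.mk_eq_zero, Submodule.Quotient.mk_eq_zero] at hx'
    exact (Submodule.Quotient.mk_eq_zero _).2 hx'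
  have h2 : Epi (mvg A B) := by
    rw [ModuleCat.epi_iff_surjective]
    intro x
    obtain ⟨x, rfl⟩ := Submodule.Quotient.mk_surjective _ x
    refine ⟨(Submodule.Quotient.mk x, 0), ?_⟩
    change Submodule.Quotient.mk x + - (Submodule.mapQ B (A ⊔ B) LinearMap.id le_sup_right) 0 = _
    simp
  refine ShortComplex.ShortExact.mk ?_
  rw [ShortComplex.moduleCat_exact_iff]
  rintro ⟨x, y⟩ h
  obtain ⟨x, rfl⟩ := Submodule.Quotient.mk_surjective _ x
  obtain ⟨y, rfl⟩ := Submodule.Quotient.mk_surjective _ y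
  have h' : (Submodule.Quotient.mk x : S ⧸ (A ⊔ B)) + -(Submodule.Quotient.mk y) = 0 := h
  rw [← sub_eq_add_neg, sub_eq_zero, Submodule.Quotient.eq] at h'
  obtain ⟨a, ha, b, hb, hab⟩ := Submodule.mem_sup.1 h'
  refine ⟨(Submodule.Quotient.mk (x - a) : S ⧸ (A ⊓ B)), ?_⟩
  change ((Submodule.Quotient.mk (x - a) : S ⧸ A), (Submodule.Quotient.mk (x - a) : S ⧸ B)) = _
  refine Prod.ext ?_ ?_
  · exact (Submodule.Quotient.eq A).2 (by simpa using ha)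
  · refine (Submodule.Quotient.eq B).2 ?_
    have : x - a - y = b := by linear_combination -hab
    rwa [this]

variable {A B}

/-- Pullback on Ext along a quotient map -/
noncomputable abbrev pb {A B : Ideal S} (h : A ≤ B) (n : ℕ) (Y : ModuleCat.{0} S) :
    OE n (Q B) Y ⟶ OE n (Q A) Y := ((Ext S (ModuleCat.{0} S) n).map (qm h).op).app Y

lemma mk0_qm_f1 : mvf A B ≫ ModuleCat.ofHom (LinearMap.fst S _ _) = qm inf_le_left := rfl
lemma mk0_qm_f2 : mvf A B ≫ ModuleCat.ofHom (LinearMap.snd S _ _) = qm inf_le_right := rfl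
lemma mk0_qm_g1 : ModuleCat.ofHom (LinearMap.inl S _ _) ≫ mvg A B = qm le_sup_left := by
  ext; simp
lemma mk0_qm_g2 : ModuleCat.ofHom (LinearMap.inr S _ _) ≫ mvg A B = - qm le_sup_right := by
  ext; simp

open Abelian.Ext in
lemma mk0_inl_inr {n : ℕ} {P₁ P₂ : Type} [AddCommGroup P₁] [AddCommGroup P₂] [Module S P₁]
    [Module S P₂] {Y : ModuleCat.{0} S}
    (x : Abelian.Ext (ModuleCat.of S (P₁ × P₂)) Y n) :
    x = (mk₀ (ModuleCat.ofHom (LinearMap.fst S P₁ P₂))).comp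
        ((mk₀ (ModuleCat.ofHom (LinearMap.inl S P₁ P₂))).comp x (zero_add n)) (zero_add n) +
      (mk₀ (ModuleCat.ofHom (LinearMap.snd S P₁ P₂))).comp
        ((mk₀ (ModuleCat.ofHom (LinearMap.inr S P₁ P₂))).comp x (zero_add n)) (zero_add n) := by
  rw [mk₀_comp_mk₀_assoc, mk₀_comp_mk₀_assoc, ← add_comp, ← mk₀_add]
  conv_lhs => rw [← mk₀_id_comp x]
  congr 2
  ext x <;> simp

lemma mv_zero (n : ℕ) (Y : ModuleCat.{0} S) (x : OE n (Q (A ⊔ B)) Y) :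
    pb (inf_le_left (a := A) (b := B)) n Y (pb le_sup_left n Y x) =
      pb (inf_le_right (a := A) (b := B)) n Y (pb le_sup_right n Y x) := by
  apply (cmp n _ Y).injective
  rw [cmp_natX, cmp_natX, cmp_natX, cmp_natX, Abelian.Ext.mk₀_comp_mk₀_assoc,
    Abelian.Ext.mk₀_comp_mk₀_assoc]
  have e : qm (inf_le_left (a := A) (b := B)) ≫ qm (le_sup_left (a := A) (b := B)) =
    qm inf_le_right ≫ qm le_sup_right := by ext; rfl
  rw [e]

/-- exactness at the middle -/
lemma mv_exact2 (n : ℕ) (Y : ModuleCat.{0} S) (a : OE n (Q A) Y) (b : OE n (Q B) Y)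
    (h : pb (inf_le_left (a := A) (b := B)) n Y a = pb inf_le_right n Y b) :
    ∃ x : OE n (Q (A ⊔ B)) Y, pb le_sup_left n Y x = a ∧ pb le_sup_right n Y x = b := by
  have h' := congrArg (cmp n _ Y) h
  rw [cmp_natX, cmp_natX] at h'
  let X₂ : Abelian.Ext (mvT A B).X₂ Y n :=
    (Abelian.Ext.mk₀ (ModuleCat.ofHom (LinearMap.fst S _ _))).comp (cmp n _ Y a) (zero_add n) -
    (Abelian.Ext.mk₀ (ModuleCat.ofHom (LinearMap.snd S _ _))).comp (cmp n _ Y b) (zero_add n)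
  have hX₂ : (Abelian.Ext.mk₀ (mvT A B).f).comp X₂ (zero_add n) = 0 := by
    simp only [X₂, comp_sub', Abelian.Ext.mk₀_comp_mk₀_assoc]
    erw [mk0_qm_f1, mk0_qm_f2]
    rw [sub_eq_zero]
    exact h'
  obtain ⟨x, hx⟩ := Abelian.Ext.contravariant_sequence_exact₂ (mvT_exact A B) Y X₂ hX₂
  refine ⟨(cmp n _ Y).symm x, ?_, ?_⟩
  · apply (cmp n _ Y).injective
    rw [cmp_natX, LinearEquiv.apply_symm_apply]
    rw [← mk0_qm_g1, ← Abelian.Ext.mk₀_comp_mk₀_assoc]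
    refine (congrArg (fun t => (Abelian.Ext.mk₀ (ModuleCat.ofHom
      (LinearMap.inl S (S ⧸ A) (S ⧸ B)))).comp t (zero_add n)) hx).trans ?_
    simp only [X₂, comp_sub', Abelian.Ext.mk₀_comp_mk₀_assoc]
    have e1 : (ModuleCat.ofHom (LinearMap.inl S (S ⧸ A) (S ⧸ B)) ≫
      ModuleCat.ofHom (LinearMap.fst S _ _)) = 𝟙 _ := rfl
    have e2 : (ModuleCat.ofHom (LinearMap.inl S (S ⧸ A) (S ⧸ B)) ≫
      ModuleCat.ofHom (LinearMap.snd S _ _)) = 0 := rfl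
    erw [e1, e2]
    simp
  · apply (cmp n _ Y).injective
    rw [cmp_natX, LinearEquiv.apply_symm_apply, ← neg_inj, ← Abelian.Ext.neg_comp,
      ← Abelian.Ext.mk₀_neg]
    rw [← mk0_qm_g2, ← Abelian.Ext.mk₀_comp_mk₀_assoc]
    refine (congrArg (fun t => (Abelian.Ext.mk₀ (ModuleCat.ofHom
      (LinearMap.inr S (S ⧸ A) (S ⧸ B)))).comp t (zero_add n)) hx).trans ?_
    simp only [X₂, comp_sub', Abelian.Ext.mk₀_comp_mk₀_assoc]
    have e1 : (ModuleCat.ofHom (LinearMap.inr S (S ⧸ A) (S ⧸ B)) ≫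
      ModuleCat.ofHom (LinearMap.fst S _ _)) = 0 := rfl
    have e2 : (ModuleCat.ofHom (LinearMap.inr S (S ⧸ A) (S ⧸ B)) ≫
      ModuleCat.ofHom (LinearMap.snd S _ _)) = 𝟙 _ := rfl
    erw [e1, e2]
    simp

lemma mk0_g (n : ℕ) (Y : ModuleCat.{0} S) (x : OE n (Q (A ⊔ B)) Y)
    (h1 : pb le_sup_left n Y x = 0) (h2 : pb le_sup_right n Y x = 0) :
    (Abelian.Ext.mk₀ (mvT A B).g).comp (cmp n _ Y x) (zero_add n) = 0 := by
  have h1' := congrArg (cmp n _ Y) h1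
  have h2' := congrArg (cmp n _ Y) h2
  rw [cmp_natX, map_zero] at h1' h2'
  refine (mk0_inl_inr _).trans ?_
  rw [Abelian.Ext.mk₀_comp_mk₀_assoc (ModuleCat.ofHom (LinearMap.inl S (S ⧸ A) (S ⧸ B)))
    (mvT A B).g, Abelian.Ext.mk₀_comp_mk₀_assoc (ModuleCat.ofHom (LinearMap.inr S (S ⧸ A) (S ⧸ B)))
    (mvT A B).g]
  erw [mk0_qm_g1, mk0_qm_g2]
  rw [h1', Abelian.Ext.mk₀_neg, Abelian.Ext.neg_comp, h2']
  simp

lemma mv_inj (Y : ModuleCat.{0} S) (x : OE 0 (Q (A ⊔ B)) Y)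
    (h1 : pb le_sup_left 0 Y x = 0) (h2 : pb le_sup_right 0 Y x = 0) : x = 0 := by
  have := mk0_g 0 Y x h1 h2
  have : Epi (mvT A B).g := (mvT_exact A B).epi_g
  apply (cmp 0 _ Y).injective
  apply Abelian.Ext.precomp_mk₀_injective_of_epi Y (mvT A B).g
  rw [map_zero, map_zero]
  exact mk0_g 0 Y x h1 h2

lemma mv_exact1 (n : ℕ) (Y : ModuleCat.{0} S) (x : OE n (Q (A ⊓ B)) Y)
    (h : dl (mvT_exact A B) n Y x = 0) :
    ∃ (a : OE n (Q A) Y) (b : OE n (Q B) Y), pb inf_le_left n Y a - pb inf_le_right n Y b = x := by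
  have h' := congrArg (cmp (n+1) _ Y) h
  rw [cmp_dl, map_zero] at h'
  obtain ⟨y, hy⟩ := Abelian.Ext.contravariant_sequence_exact₁ (mvT_exact A B) Y _ _ h'
  refine ⟨(cmp n _ Y).symm ((Abelian.Ext.mk₀ (ModuleCat.ofHom (LinearMap.inl S _ _))).comp y
    (zero_add n)), -(cmp n _ Y).symm ((Abelian.Ext.mk₀ (ModuleCat.ofHom
      (LinearMap.inr S _ _))).comp y (zero_add n)), ?_⟩
  apply (cmp n _ Y).injective
  rw [← hy, map_neg, sub_neg_eq_add, map_add, cmp_natX, cmp_natX]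
  rw [LinearEquiv.apply_symm_apply, LinearEquiv.apply_symm_apply]
  conv_rhs => rw [mk0_inl_inr y]
  rw [Abelian.Ext.comp_add, ← mk0_qm_f1, ← mk0_qm_f2]
  simp only [Abelian.Ext.mk₀_comp_mk₀_assoc]
  rfl

lemma mv_dl_zero (n : ℕ) (Y : ModuleCat.{0} S) (a : OE n (Q A) Y) (b : OE n (Q B) Y) :
    dl (mvT_exact A B) n Y (pb inf_le_left n Y a - pb inf_le_right n Y b) = 0 := by
  apply (cmp (n+1) _ Y).injective
  rw [cmp_dl, map_zero, map_sub]
  rw [cmp_natX, cmp_natX, ← mk0_qm_f1, ← mk0_qm_f2, ← Abelian.Ext.mk₀_comp_mk₀_assoc,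
    ← Abelian.Ext.mk₀_comp_mk₀_assoc, ← comp_sub']
  exact (mvT_exact A B).extClass_comp_assoc _

lemma mv_exact3 (n : ℕ) (Y : ModuleCat.{0} S) (x : OE (n+1) (Q (A ⊔ B)) Y)
    (h1 : pb le_sup_left (n+1) Y x = 0) (h2 : pb le_sup_right (n+1) Y x = 0) :
    ∃ y, dl (mvT_exact A B) n Y y = x := by
  obtain ⟨y, hy⟩ := Abelian.Ext.contravariant_sequence_exact₃ (mvT_exact A B) Y _
    (mk0_g (n+1) Y x h1 h2) (add_comm 1 n)
  refine ⟨(cmp n _ Y).symm y, ?_⟩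
  apply (cmp (n+1) _ Y).injective
  rw [cmp_dl, LinearEquiv.apply_symm_apply]
  exact hy

lemma mv_dl_left (n : ℕ) (Y : ModuleCat.{0} S) (y : OE n (Q (A ⊓ B)) Y) :
    pb le_sup_left (n+1) Y (dl (mvT_exact A B) n Y y) = 0 := by
  apply (cmp (n+1) _ Y).injective
  rw [cmp_natX, map_zero, ← mk0_qm_g1, ← Abelian.Ext.mk₀_comp_mk₀_assoc]
  erw [cmp_dl (mvT_exact A B) n Y y, (mvT_exact A B).comp_extClass_assoc]
  simp

lemma mv_dl_right (n : ℕ) (Y : ModuleCat.{0} S) (y : OE n (Q (A ⊓ B)) Y) :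
    pb le_sup_right (n+1) Y (dl (mvT_exact A B) n Y y) = 0 := by
  apply (cmp (n+1) _ Y).injective
  rw [cmp_natX, map_zero, ← neg_inj, ← Abelian.Ext.neg_comp, ← Abelian.Ext.mk₀_neg,
    ← mk0_qm_g2, ← Abelian.Ext.mk₀_comp_mk₀_assoc]
  erw [cmp_dl (mvT_exact A B) n Y y, (mvT_exact A B).comp_extClass_assoc]
  simp

end MV

section diag
open localCohomology

lemma app_congr {F G : ModuleCat.{0} S ⥤ ModuleCat.{0} S} {f g : F ⟶ G} (M : ModuleCat.{0} S)
    (x : F.obj M) (h : f = g) : f.app M x = g.app M x := by rw [h]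

lemma pb_pb {A B C : Ideal S} (h : A ≤ B) (h' : B ≤ C) (n : ℕ) (Y : ModuleCat.{0} S)
    (x : OE n (Q C) Y) : pb h n Y (pb h' n Y x) = pb (h.trans h') n Y x := by
  apply (cmp n _ Y).injective
  rw [cmp_natX, cmp_natX, cmp_natX, Abelian.Ext.mk₀_comp_mk₀_assoc]
  have e : qm h ≫ qm h' = qm (h.trans h') := by ext; rfl
  rw [e]

lemma leF (F : ℕᵒᵖ ⥤ Ideal S) {k l : ℕ} (h : k ≤ l) : F.obj (op l) ≤ F.obj (op k) :=
  (F.map (homOfLE h).op).down.down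

instance (F : ℕᵒᵖ ⥤ Ideal S) (i : ℕ) : HasColimit (diagram F i) := hasColimitDiagram.{0,0} F i

noncomputable def io (F : ℕᵒᵖ ⥤ Ideal S) (i : ℕ) (M : ModuleCat.{0} S) (k : ℕ) :
    OE i (Q (F.obj (op k))) M ⟶ (ofDiagram.{0,0} F i).obj M :=
  (colimit.ι (diagram F i) (op (op k))).app M

lemma io_pb (F : ℕᵒᵖ ⥤ Ideal S) (i : ℕ) (M : ModuleCat.{0} S) {k l : ℕ} (h : k ≤ l)
    (x : OE i (Q (F.obj (op k))) M) :
    io F i M l (pb (leF F h) i M x) = io F i M k x := by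
  have := app_congr M x
    (colimit.w (diagram F i) (homOfLE h).op.op)
  exact this

noncomputable def cocI (F : ℕᵒᵖ ⥤ Ideal S) (i : ℕ) (M : ModuleCat.{0} S) :
    IsColimit (((evaluation _ _).obj M).mapCocone (colimit.cocone (diagram F i))) :=
  isColimitOfPreserves _ (colimit.isColimit _)

lemma io_rep (F : ℕᵒᵖ ⥤ Ideal S) (i : ℕ) (M : ModuleCat.{0} S)
    (x : (ofDiagram.{0,0} F i).obj M) : ∃ k y, io F i M k y = x := by
  obtain ⟨k, y, h⟩ := Concrete.isColimit_exists_rep _ (cocI F i M) x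
  exact ⟨k.unop.unop, y, h⟩

lemma io_zero (F : ℕᵒᵖ ⥤ Ideal S) (i : ℕ) (M : ModuleCat.{0} S) (k : ℕ)
    (x : OE i (Q (F.obj (op k))) M) (hx : io F i M k x = 0) :
    ∃ l, ∃ h : k ≤ l, pb (leF F h) i M x = 0 := by
  have : (((evaluation _ _).obj M).mapCocone (colimit.cocone (diagram F i))).ι.app (op (op k)) x =
     (((evaluation _ _).obj M).mapCocone (colimit.cocone (diagram F i))).ι.app (op (op k)) 0 := by
    refine Eq.trans hx (Eq.symm ?_)
    exact map_zero (io F i M k).hom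
  obtain ⟨l, f, g, h⟩ := (Concrete.isColimit_rep_eq_iff_exists _ (cocI F i M) x 0).1 this
  refine ⟨l.unop.unop, leOfHom f.unop.unop, ?_⟩
  refine Eq.trans h ?_
  exact map_zero (ModuleCat.Hom.hom _)

noncomputable def resD {F G : ℕᵒᵖ ⥤ Ideal S} (h : ∀ t, F.obj t ≤ G.obj t) (i : ℕ) :
    diagram G i ⟶ diagram F i :=
  Functor.whiskerRight (NatTrans.op
    ({ app := fun t => qm (h t)
       naturality := by
        intro a b f
        apply ModuleCat.hom_ext
        apply Submodule.linearMap_qext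
        rfl } : ringModIdeals F ⟶ ringModIdeals G)) _

noncomputable def res {F G : ℕᵒᵖ ⥤ Ideal S} (h : ∀ t, F.obj t ≤ G.obj t) (i : ℕ) :
    ofDiagram.{0,0} G i ⟶ ofDiagram.{0,0} F i := colimMap (resD h i)

lemma res_io {F G : ℕᵒᵖ ⥤ Ideal S} (h : ∀ t, F.obj t ≤ G.obj t) (i : ℕ) (M : ModuleCat.{0} S)
    (k : ℕ) (x : OE i (Q (G.obj (op k))) M) :
    (res h i).app M (io G i M k x) = io F i M k (pb (h (op k)) i M x) := by
  have := app_congr M x (ι_colimMap (resD h i) (op (op k)))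
  exact this

def supF (F G : ℕᵒᵖ ⥤ Ideal S) : ℕᵒᵖ ⥤ Ideal S where
  obj t := F.obj t ⊔ G.obj t
  map w := homOfLE (sup_le_sup (leOfHom (F.map w)) (leOfHom (G.map w)))

def infF (F G : ℕᵒᵖ ⥤ Ideal S) : ℕᵒᵖ ⥤ Ideal S where
  obj t := F.obj t ⊓ G.obj t
  map w := homOfLE (inf_le_inf (leOfHom (F.map w)) (leOfHom (G.map w)))

noncomputable def mvMap {A B A' B' : Ideal S} (hA : A ≤ A') (hB : B ≤ B') :
    mvT A B ⟶ mvT A' B' where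
  τ₁ := qm (inf_le_inf hA hB)
  τ₂ := ModuleCat.ofHom (LinearMap.prodMap (Submodule.mapQ A A' LinearMap.id hA)
    (Submodule.mapQ B B' LinearMap.id hB))
  τ₃ := qm (sup_le_sup hA hB)
  comm₁₂ := by
    apply ModuleCat.hom_ext
    apply Submodule.linearMap_qext
    rfl
  comm₂₃ := by
    apply ModuleCat.hom_ext
    apply LinearMap.prod_ext <;> apply Submodule.linearMap_qext <;> ext <;> simp

noncomputable def delD (F G : ℕᵒᵖ ⥤ Ideal S) (i : ℕ) :
    diagram (infF F G) i ⟶ diagram (supF F G) (i+1) where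
  app t := dlN (mvT_exact (F.obj t.unop) (G.obj t.unop)) i
  naturality a b f := dlN_natural (mvT_exact (F.obj b.unop) (G.obj b.unop))
    (mvT_exact (F.obj a.unop) (G.obj a.unop))
    (mvMap (leOfHom (F.map f.unop)) (leOfHom (G.map f.unop))) i

noncomputable def del (F G : ℕᵒᵖ ⥤ Ideal S) (i : ℕ) :
    ofDiagram.{0,0} (infF F G) i ⟶ ofDiagram.{0,0} (supF F G) (i+1) := colimMap (delD F G i)

lemma del_io (F G : ℕᵒᵖ ⥤ Ideal S) (i : ℕ) (M : ModuleCat.{0} S)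
    (k : ℕ) (x : OE i (Q (F.obj (op k) ⊓ G.obj (op k))) M) :
    (del F G i).app M (io (infF F G) i M k x) =
      io (supF F G) (i+1) M k (dl (mvT_exact (F.obj (op k)) (G.obj (op k))) i M x) := by
  have := app_congr M x (ι_colimMap (delD F G i) (op (op k)))
  exact this

lemma le1 (F G : ℕᵒᵖ ⥤ Ideal S) (t : ℕᵒᵖ) : F.obj t ≤ (supF F G).obj t :=
  le_sup_left (a := F.obj t) (b := G.obj t)
lemma le2 (F G : ℕᵒᵖ ⥤ Ideal S) (t : ℕᵒᵖ) : G.obj t ≤ (supF F G).obj t :=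
  le_sup_right (a := F.obj t) (b := G.obj t)
lemma le3 (F G : ℕᵒᵖ ⥤ Ideal S) (t : ℕᵒᵖ) : (infF F G).obj t ≤ F.obj t :=
  inf_le_left (a := F.obj t) (b := G.obj t)
lemma le4 (F G : ℕᵒᵖ ⥤ Ideal S) (t : ℕᵒᵖ) : (infF F G).obj t ≤ G.obj t :=
  inf_le_right (a := F.obj t) (b := G.obj t)

variable (F G : ℕᵒᵖ ⥤ Ideal S) (i : ℕ) (M : ModuleCat.{0} S)

noncomputable def uu := res (F := F) (G := supF F G) (le1 F G) i
noncomputable def vv := res (F := G) (G := supF F G) (le2 F G) i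
noncomputable def ww := res (F := infF F G) (G := F) (le3 F G) i
noncomputable def zz := res (F := infF F G) (G := G) (le4 F G) i

lemma pb_dl {A B A' B' : Ideal S} (hA : A ≤ A') (hB : B ≤ B') (x : OE i (Q (A' ⊓ B')) M) :
    pb (sup_le_sup hA hB) (i+1) M (dl (mvT_exact A' B') i M x) =
      dl (mvT_exact A B) i M (pb (inf_le_inf hA hB) i M x) := by
  exact (app_congr M x (dlN_natural (mvT_exact A B) (mvT_exact A' B')
    (mvMap hA hB) i)).symm

/-- two zeros at a common level -/
lemma io_zero2 {F G H : ℕᵒᵖ ⥤ Ideal S} (h1 : ∀ t, F.obj t ≤ H.obj t) (h2 : ∀ t, G.obj t ≤ H.obj t)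
    (k : ℕ) (x : OE i (Q (H.obj (op k))) M) (hF : (res h1 i).app M (io H i M k x) = 0)
    (hG : (res h2 i).app M (io H i M k x) = 0) :
    ∃ l, ∃ h : k ≤ l, pb (h1 (op l)) i M (pb (leF H h) i M x) = 0 ∧
      pb (h2 (op l)) i M (pb (leF H h) i M x) = 0 := by
  rw [res_io] at hF hG
  obtain ⟨l1, hl1, e1⟩ := io_zero _ _ _ _ _ hF
  obtain ⟨l2, hl2, e2⟩ := io_zero _ _ _ _ _ hG
  refine ⟨max l1 l2, hl1.trans (le_max_left _ _), ?_, ?_⟩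
  · have := congrArg (pb (leF F (le_max_left l1 l2)) i M) e1
    rw [pb_pb, pb_pb] at this
    rw [pb_pb]
    exact this.trans (map_zero (ModuleCat.Hom.hom _))
  · have := congrArg (pb (leF G (le_max_right l1 l2)) i M) e2
    rw [pb_pb, pb_pb] at this
    rw [pb_pb]
    exact this.trans (map_zero (ModuleCat.Hom.hom _))

lemma ex0 (x) (h1 : (uu F G 0).app M x = 0) (h2 : (vv F G 0).app M x = 0) : x = 0 := by
  obtain ⟨k, x, rfl⟩ := io_rep _ _ _ x
  obtain ⟨l, hl, e1, e2⟩ := io_zero2 0 M _ _ k x h1 h2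
  rw [← io_pb _ _ _ hl]
  refine (congrArg _ (mv_inj M _ e1 e2)).trans (map_zero (ModuleCat.Hom.hom _))

lemma ex1 (x) : (ww F G i).app M ((uu F G i).app M x) = (zz F G i).app M ((vv F G i).app M x) := by
  obtain ⟨k, x, rfl⟩ := io_rep _ _ _ x
  unfold ww uu zz vv
  rw [res_io, res_io, res_io, res_io]
  exact congrArg _ (mv_zero i M x)

lemma ex2 (a b) (h : (ww F G i).app M a = (zz F G i).app M b) :
    ∃ x, (uu F G i).app M x = a ∧ (vv F G i).app M x = b := by
  obtain ⟨k1, a, rfl⟩ := io_rep _ _ _ a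
  obtain ⟨k2, b, rfl⟩ := io_rep _ _ _ b
  have hk1 := le_max_left k1 k2
  have hk2 := le_max_right k1 k2
  generalize max k1 k2 = k at hk1 hk2
  rw [← io_pb _ _ _ hk1] at h ⊢
  rw [← io_pb _ _ _ hk2] at h ⊢
  generalize pb (leF F hk1) i M a = a at *
  generalize pb (leF G hk2) i M b = b at *
  unfold ww zz at h
  rw [res_io, res_io, ← sub_eq_zero, ← map_sub] at h
  obtain ⟨l, hl, e⟩ := io_zero _ _ _ _ _ h
  rw [map_sub, sub_eq_zero, pb_pb, pb_pb] at e
  obtain ⟨x, h1, h2⟩ := mv_exact2 i M (pb (leF F hl) i M a) (pb (leF G hl) i M b) (by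
    rw [pb_pb, pb_pb]; exact e)
  refine ⟨io (supF F G) i M l x, ?_, ?_⟩
  · unfold uu
    refine (res_io (le1 F G) i M l x).trans ?_
    rw [← io_pb _ _ _ hl]
    exact congrArg (io F i M l) h1
  · unfold vv
    refine (res_io (le2 F G) i M l x).trans ?_
    rw [← io_pb _ _ _ hl]
    exact congrArg (io G i M l) h2

lemma ex3 (a b) : (del F G i).app M ((ww F G i).app M a - (zz F G i).app M b) = 0 := by
  obtain ⟨k1, a, rfl⟩ := io_rep _ _ _ a
  obtain ⟨k2, b, rfl⟩ := io_rep _ _ _ b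
  have hk1 := le_max_left k1 k2
  have hk2 := le_max_right k1 k2
  generalize max k1 k2 = k at hk1 hk2
  rw [← io_pb _ _ _ hk1]
  rw [← io_pb _ _ _ hk2]
  generalize pb (leF F hk1) i M a = a at *
  generalize pb (leF G hk2) i M b = b at *
  unfold ww zz
  rw [res_io, res_io, ← map_sub]
  refine (del_io F G i M k _).trans ?_
  exact (congrArg _ (mv_dl_zero i M a b)).trans (map_zero (ModuleCat.Hom.hom _))

lemma ex4 (x) (h : (del F G i).app M x = 0) :
    ∃ a b, (ww F G i).app M a - (zz F G i).app M b = x := by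
  obtain ⟨k, x, rfl⟩ := io_rep _ _ _ x
  erw [del_io] at h
  obtain ⟨l, hl, e⟩ := io_zero _ _ _ _ _ h
  have e' := (pb_dl i M (leF F hl) (leF G hl) x).symm.trans e
  obtain ⟨a, b, hab⟩ := mv_exact1 i M _ e'
  refine ⟨io F i M l a, io G i M l b, ?_⟩
  unfold ww zz
  rw [res_io, res_io, ← map_sub, ← io_pb _ _ _ hl]
  exact congrArg _ hab

lemma ex5 (x) : (uu F G (i+1)).app M ((del F G i).app M x) = 0 := by
  obtain ⟨k, x, rfl⟩ := io_rep _ _ _ x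
  unfold uu
  refine (congrArg _ (del_io F G i M k x)).trans ?_
  refine (res_io _ _ _ _ _).trans ?_
  exact (congrArg _ (mv_dl_left i M x)).trans (map_zero (ModuleCat.Hom.hom _))

lemma ex6 (x) : (vv F G (i+1)).app M ((del F G i).app M x) = 0 := by
  obtain ⟨k, x, rfl⟩ := io_rep _ _ _ x
  unfold vv
  refine (congrArg _ (del_io F G i M k x)).trans ?_
  refine (res_io _ _ _ _ _).trans ?_
  exact (congrArg _ (mv_dl_right i M x)).trans (map_zero (ModuleCat.Hom.hom _))

lemma ex7 (x) (h1 : (uu F G (i+1)).app M x = 0) (h2 : (vv F G (i+1)).app M x = 0) :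
    ∃ y, (del F G i).app M y = x := by
  obtain ⟨k, x, rfl⟩ := io_rep _ _ _ x
  obtain ⟨l, hl, e1, e2⟩ := io_zero2 (i+1) M _ _ k x h1 h2
  obtain ⟨y, hy⟩ := mv_exact3 i M _ e1 e2
  refine ⟨io (infF F G) i M l y, ?_⟩
  rw [← io_pb _ _ _ hl]
  exact (del_io F G i M l y).trans (congrArg _ hy)

end diag

section cofinal
open localCohomology

variable [IsNoetherianRing S]

/-- Lift to the category of ideals with large radical. -/
def liftF (K : Ideal S) (F : ℕᵒᵖ ⥤ Ideal S) (h1 : ∀ t, K ≤ (F.obj t).radical) :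
    ℕᵒᵖ ⥤ SelfLERadical K := ObjectProperty.lift _ F h1

lemma liftF_initial (K : Ideal S) (F : ℕᵒᵖ ⥤ Ideal S) (h1 : ∀ t, K ≤ (F.obj t).radical)
    (h2 : ∀ k, ∃ t : ℕ, F.obj (op t) ≤ K ^ k) : Functor.Initial (liftF K F h1) where
  out J' := by
    apply +allowSynthFailures zigzag_isConnected
    · obtain ⟨k, hk⟩ := Ideal.exists_pow_le_of_le_radical_of_fg J'.2
        (isNoetherian_def.mp inferInstance _)
      obtain ⟨t, ht⟩ := h2 k
      exact ⟨CostructuredArrow.mk (⟨⟨⟨ht.trans hk⟩⟩⟩ : (liftF K F h1).obj (op t) ⟶ J')⟩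
    · intro j1 j2
      apply Relation.ReflTransGen.single
      rcases le_total (unop j1.left) (unop j2.left) with h | h
      · right; exact ⟨CostructuredArrow.homMk (homOfLE h).op rfl⟩
      · left; exact ⟨CostructuredArrow.homMk (homOfLE h).op rfl⟩

noncomputable def isoF (K : Ideal S) (F : ℕᵒᵖ ⥤ Ideal S) (h1 : ∀ t, K ≤ (F.obj t).radical)
    (h2 : ∀ k, ∃ t : ℕ, F.obj (op t) ≤ K ^ k) (i : ℕ) :
    ofDiagram.{0,0} F i ≅ localCohomology K i :=
  haveI := liftF_initial K F h1 h2
  (isoOfFinal.{0,0,0} (liftF K F h1) (selfLERadicalDiagram K) i) ≪≫ isoSelfLERadical K i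

lemma sup_h1 (I J : Ideal S) (t : ℕᵒᵖ) :
    I ⊔ J ≤ ((supF (idealPowersDiagram I) (idealPowersDiagram J)).obj t).radical := by
  change I ⊔ J ≤ (I ^ unop t ⊔ J ^ unop t).radical
  refine sup_le (fun x hx => ⟨unop t, ?_⟩) (fun x hx => ⟨unop t, ?_⟩)
  · exact Ideal.mem_sup_left (Ideal.pow_mem_pow hx _)
  · exact Ideal.mem_sup_right (Ideal.pow_mem_pow hx _)

lemma sup_h2 (I J : Ideal S) (k : ℕ) :
    ∃ t : ℕ, (supF (idealPowersDiagram I) (idealPowersDiagram J)).obj (op t) ≤ (I ⊔ J) ^ k :=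
  ⟨k, sup_le (Ideal.pow_right_mono le_sup_left k) (Ideal.pow_right_mono le_sup_right k)⟩

lemma inf_h1 (I J : Ideal S) (t : ℕᵒᵖ) :
    I ⊓ J ≤ ((infF (idealPowersDiagram I) (idealPowersDiagram J)).obj t).radical :=
  fun _ hx => ⟨unop t, Ideal.pow_mem_pow hx.1 _, Ideal.pow_mem_pow hx.2 _⟩

lemma inf_h2 (I J : Ideal S) (k : ℕ) :
    ∃ t : ℕ, (infF (idealPowersDiagram I) (idealPowersDiagram J)).obj (op t) ≤ (I ⊓ J) ^ k := by
  obtain ⟨c, hc⟩ := Ideal.exists_pow_inf_eq_pow_smul I (J ^ k : Submodule S S)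
  refine ⟨k + c, ?_⟩
  change I ^ (k + c) ⊓ J ^ (k + c) ≤ _
  have h := hc (k + c) (by lia)
  have hs : (I ^ (k+c) • (⊤ : Submodule S S)) = I ^ (k+c) := by simp
  rw [hs] at h
  calc I ^ (k + c) ⊓ J ^ (k + c) ≤ I ^ (k + c) ⊓ J ^ k :=
        inf_le_inf_left _ (Ideal.pow_le_pow_right (by lia))
    _ ≤ I ^ k * J ^ k := by
        refine h.le.trans ?_
        rw [Nat.add_sub_cancel]
        exact Submodule.smul_mono le_rfl inf_le_right
    _ = (I * J) ^ k := (mul_pow _ _ _).symm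
    _ ≤ (I ⊓ J) ^ k := Ideal.pow_right_mono Ideal.mul_le_inf k

end cofinal
end LCMV

/-- The Mayer–Vietoris long exact sequence for local cohomology:
`0 → H^0_{I+J}(M) → H^0_I(M) ⊕ H^0_J(M) → H^0_{I∩J}(M) → H^1_{I+J}(M) → ⋯`,
functorial in `M` (the maps are natural transformations of functors). -/
theorem localCohomology_mayerVietoris
    {S : Type} [CommRing S] [IsNoetherianRing S] (I J : Ideal S) :
    ∃ (u : ∀ i : ℕ, localCohomology (I ⊔ J) i ⟶ localCohomology I i)
      (v : ∀ i : ℕ, localCohomology (I ⊔ J) i ⟶ localCohomology J i)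
      (w : ∀ i : ℕ, localCohomology I i ⟶ localCohomology (I ⊓ J) i)
      (z : ∀ i : ℕ, localCohomology J i ⟶ localCohomology (I ⊓ J) i)
      (δ : ∀ i : ℕ, localCohomology (I ⊓ J) i ⟶ localCohomology (I ⊔ J) (i + 1)),
      ∀ M : ModuleCat S,
        (Function.Injective fun x : (localCohomology (I ⊔ J) 0).obj M =>
            (((u 0).app M) x, ((v 0).app M) x)) ∧
        (∀ i : ℕ, Function.Exact
            (fun x : (localCohomology (I ⊔ J) i).obj M =>
              (((u i).app M) x, ((v i).app M) x))
            (fun y : ((localCohomology I i).obj M) × ((localCohomology J i).obj M) =>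
              ((w i).app M) y.1 - ((z i).app M) y.2)) ∧
        (∀ i : ℕ, Function.Exact
            (fun y : ((localCohomology I i).obj M) × ((localCohomology J i).obj M) =>
              ((w i).app M) y.1 - ((z i).app M) y.2)
            ((δ i).app M)) ∧
        (∀ i : ℕ, Function.Exact ((δ i).app M)
            (fun x : (localCohomology (I ⊔ J) (i + 1)).obj M =>
              (((u (i + 1)).app M) x, ((v (i + 1)).app M) x))) := by
  let F := localCohomology.idealPowersDiagram I
  let G := localCohomology.idealPowersDiagram J
  let es : ∀ i, localCohomology.ofDiagram.{0,0} (LCMV.supF F G) i ≅ localCohomology (I ⊔ J) i :=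
    LCMV.isoF (I ⊔ J) _ (LCMV.sup_h1 I J) (LCMV.sup_h2 I J)
  let ei : ∀ i, localCohomology.ofDiagram.{0,0} (LCMV.infF F G) i ≅ localCohomology (I ⊓ J) i :=
    LCMV.isoF (I ⊓ J) _ (LCMV.inf_h1 I J) (LCMV.inf_h2 I J)
  refine ⟨fun i => (es i).inv ≫ LCMV.uu F G i, fun i => (es i).inv ≫ LCMV.vv F G i,
    fun i => LCMV.ww F G i ≫ (ei i).hom, fun i => LCMV.zz F G i ≫ (ei i).hom,
    fun i => (ei i).inv ≫ LCMV.del F G i ≫ (es (i+1)).hom, fun M => ?_⟩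
  have his : ∀ i x, (es i).hom.app M ((es i).inv.app M x) = x := fun i x =>
    LCMV.app_congr M x (es i).inv_hom_id
  have hsi : ∀ i x, (es i).inv.app M ((es i).hom.app M x) = x := fun i x =>
    LCMV.app_congr M x (es i).hom_inv_id
  have hii : ∀ i x, (ei i).hom.app M ((ei i).inv.app M x) = x := fun i x =>
    LCMV.app_congr M x (ei i).inv_hom_id
  have hij : ∀ i x, (ei i).inv.app M ((ei i).hom.app M x) = x := fun i x =>
    LCMV.app_congr M x (ei i).hom_inv_id
  refine ⟨?_, fun i => ?_, fun i => ?_, fun i => ?_⟩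
  · intro x y hxy
    obtain ⟨h1, h2⟩ := Prod.mk.inj hxy
    have h1' : (LCMV.uu F G 0).app M ((es 0).inv.app M x) =
      (LCMV.uu F G 0).app M ((es 0).inv.app M y) := h1
    have h2' : (LCMV.vv F G 0).app M ((es 0).inv.app M x) =
      (LCMV.vv F G 0).app M ((es 0).inv.app M y) := h2
    have := LCMV.ex0 F G M ((es 0).inv.app M x - (es 0).inv.app M y)
      (by rw [map_sub, h1', sub_self]) (by rw [map_sub, h2', sub_self])
    rw [sub_eq_zero] at this
    rw [← his 0 x, this, his]
  · rintro ⟨a, b⟩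
    constructor
    · intro h
      have h' : (ei i).hom.app M ((LCMV.ww F G i).app M a) -
        (ei i).hom.app M ((LCMV.zz F G i).app M b) = 0 := h
      rw [sub_eq_zero] at h'
      have h2 := congrArg ((ei i).inv.app M) h'
      rw [hij, hij] at h2
      obtain ⟨x, h1, h2⟩ := LCMV.ex2 F G i M a b h2
      refine ⟨(es i).hom.app M x, ?_⟩
      refine Prod.ext ?_ ?_
      · change (LCMV.uu F G i).app M ((es i).inv.app M ((es i).hom.app M x)) = a
        rw [hsi, h1]
      · change (LCMV.vv F G i).app M ((es i).inv.app M ((es i).hom.app M x)) = b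
        rw [hsi, h2]
    · rintro ⟨x, hx⟩
      obtain ⟨rfl, rfl⟩ := Prod.mk.inj hx
      change (ei i).hom.app M ((LCMV.ww F G i).app M ((LCMV.uu F G i).app M
        ((es i).inv.app M x))) - (ei i).hom.app M ((LCMV.zz F G i).app M ((LCMV.vv F G i).app M
        ((es i).inv.app M x))) = 0
      rw [LCMV.ex1, sub_self]
  · intro x
    constructor
    · intro h
      have h' : (es (i+1)).hom.app M ((LCMV.del F G i).app M ((ei i).inv.app M x)) = 0 := h
      have h2 := congrArg ((es (i+1)).inv.app M) h'
      rw [hsi, map_zero] at h2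
      obtain ⟨a, b, hab⟩ := LCMV.ex4 F G i M _ h2
      refine ⟨(a, b), ?_⟩
      change (ei i).hom.app M ((LCMV.ww F G i).app M a) -
        (ei i).hom.app M ((LCMV.zz F G i).app M b) = x
      rw [← map_sub, hab, hii]
    · rintro ⟨⟨a, b⟩, rfl⟩
      change (es (i+1)).hom.app M ((LCMV.del F G i).app M ((ei i).inv.app M
        ((ei i).hom.app M ((LCMV.ww F G i).app M a) -
        (ei i).hom.app M ((LCMV.zz F G i).app M b)))) = 0
      rw [← map_sub, hij]
      exact (congrArg _ (LCMV.ex3 F G i M a b)).trans (map_zero (ModuleCat.Hom.hom _))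
  · intro x
    constructor
    · intro h
      obtain ⟨h1, h2⟩ := Prod.mk.inj h
      obtain ⟨y, hy⟩ := LCMV.ex7 F G i M ((es (i+1)).inv.app M x) h1 h2
      refine ⟨(ei i).hom.app M y, ?_⟩
      change (es (i+1)).hom.app M ((LCMV.del F G i).app M ((ei i).inv.app M
        ((ei i).hom.app M y))) = x
      rw [hij, hy, his]
    · rintro ⟨y, rfl⟩
      refine Prod.ext ?_ ?_
      · change (LCMV.uu F G (i+1)).app M ((es (i+1)).inv.app M ((es (i+1)).hom.app M
          ((LCMV.del F G i).app M ((ei i).inv.app M y)))) = 0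
        rw [hsi, LCMV.ex5]
      · change (LCMV.vv F G (i+1)).app M ((es (i+1)).inv.app M ((es (i+1)).hom.app M
          ((LCMV.del F G i).app M ((ei i).inv.app M y)))) = 0
        rw [hsi, LCMV.ex6]
end

section
/- Let S be a Noetherian local ring with maximal ideal 𝔪 and M a finitely generated S-module. If i > dim M, then H^i_𝔪(M) = 0. -/
open CategoryTheory

namespace LCVanish
open Abelian Limits Opposite

variable {S : Type} [CommRing S]

/-- Dimension shifting in the first variable, with its functoriality. -/
lemma exists_shift {A : ShortComplex (ModuleCat.{0} S)} (hA : A.ShortExact) [Projective A.X₂]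
    {M : ModuleCat.{0} S} {i : ℕ} (α : Ext A.X₃ M (i + 1)) :
    ∃ β : Ext A.X₁ M i, ∀ (B : ShortComplex (ModuleCat.{0} S)) (_ : B.ShortExact) (φ : B ⟶ A),
      (Ext.mk₀ φ.τ₁).comp β (zero_add i) = 0 →
      (Ext.mk₀ φ.τ₃).comp α (zero_add (i + 1)) = 0 := by
  obtain ⟨β, hβ⟩ := Ext.contravariant_sequence_exact₃ hA M α
    (Ext.eq_zero_of_projective _) (add_comm 1 i)
  refine ⟨β, fun B hB φ h => ?_⟩
  rw [← hβ, ← Ext.comp_assoc (a₁₂ := 1) _ _ _ (by lia) (by lia) (by lia),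
    ← ShortComplex.ShortExact.extClass_naturality hB hA φ,
    Ext.comp_assoc (a₂₃ := i) _ _ _ (by lia) (by lia) (by lia), h, Ext.comp_zero]

/-- The short exact sequence attached to a surjective linear map. -/
lemma shortExact_ker {N P : Type} [AddCommGroup N] [Module S N] [AddCommGroup P] [Module S P]
    (f : P →ₗ[S] N) (hf : Function.Surjective f) :
    (ShortComplex.mk (ModuleCat.ofHom (LinearMap.ker f).subtype) (ModuleCat.ofHom f)
      (by ext x; simp)).ShortExact :=
  LinearMap.shortExact_shortComplexKer hf

lemma exists_restrict_zero [IsNoetherianRing S] (I : Ideal S) (M : ModuleCat.{0} S)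
    (hM : ∀ x ∈ I, ∀ y : M, x • y = 0) (i : ℕ) :
    ∀ (N : Type) [AddCommGroup N] [Module S N] [Module.Finite S N]
      (α : Ext (ModuleCat.of S N) M i),
      ∃ s : ℕ, (Ext.mk₀ (ModuleCat.ofHom (I ^ s • ⊤ : Submodule S N).subtype)).comp α
        (zero_add i) = 0 := by
  induction i with
  | zero =>
    intro N _ _ _ α
    obtain ⟨f, rfl⟩ := (Ext.mk₀_bijective _ _).2 α
    refine ⟨1, ?_⟩
    rw [Ext.mk₀_comp_mk₀]
    suffices h0 : ModuleCat.ofHom (I ^ 1 • ⊤ : Submodule S N).subtype ≫ f = 0 by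
      rw [h0, Ext.mk₀_zero]
    ext ⟨x, hx0⟩
    change f.hom x = 0
    have hx : x ∈ I • (⊤ : Submodule S N) := by rwa [pow_one] at hx0
    clear hx0
    induction hx using Submodule.smul_induction_on' with
    | smul r hr n hn => rw [map_smul]; exact hM r hr _
    | add x hx y hy h1 h2 => rw [map_add, h1, h2, add_zero]
  | succ i ih =>
    intro N _ _ _ α
    obtain ⟨n, f, hf⟩ := Module.Finite.exists_fin' S N
    have : Projective (ModuleCat.of S (Fin n → S)) := 
      (IsProjective.iff_projective (R := S) (Fin n → S)).1 inferInstance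
    obtain ⟨β, hβ⟩ := exists_shift (shortExact_ker f hf) (M := M) α
    obtain ⟨r, hr⟩ := ih _ β
    obtain ⟨k, hk⟩ := Ideal.exists_pow_inf_eq_pow_smul I (LinearMap.ker f)
    refine ⟨r + k, ?_⟩
    let P' : Submodule S (Fin n → S) := I ^ (r + k) • ⊤
    let N' : Submodule S N := I ^ (r + k) • ⊤
    have hmap : P'.map f = N' := by
      rw [Submodule.map_smul'', Submodule.map_top, LinearMap.range_eq_top.2 hf]
    let f' : P' →ₗ[S] N' := f.restrict (fun x hx => hmap ▸ Submodule.mem_map_of_mem hx)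
    have hf' : Function.Surjective f' := by
      rintro ⟨y, hy⟩
      rw [← hmap] at hy
      obtain ⟨x, hx, rfl⟩ := hy
      exact ⟨⟨x, hx⟩, rfl⟩
    have key : ∀ x : LinearMap.ker f', (⟨x.1.1, congrArg Subtype.val x.2⟩ : LinearMap.ker f) ∈
        (I ^ r • ⊤ : Submodule S (LinearMap.ker f)) := by
      intro x
      have h1 : x.1.1 ∈ I ^ (r + k) • (⊤ : Submodule S (Fin n → S)) ⊓ LinearMap.ker f :=
        ⟨x.1.2, congrArg Subtype.val x.2⟩
      rw [hk _ (by lia), Nat.add_sub_cancel] at h1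
      have h2 : x.1.1 ∈ (I ^ r • ⊤ : Submodule S (LinearMap.ker f)).map
          (LinearMap.ker f).subtype := by
        rw [Submodule.map_smul'', Submodule.map_top, Submodule.range_subtype]
        exact Submodule.smul_mono le_rfl inf_le_right h1
      obtain ⟨z, hz, hzx⟩ := h2
      exact (Subtype.ext hzx : z = ⟨x.1.1, congrArg Subtype.val x.2⟩) ▸ hz
    let g : LinearMap.ker f' →ₗ[S] (I ^ r • ⊤ : Submodule S (LinearMap.ker f)) :=
      { toFun := fun x => ⟨_, key x⟩
        map_add' := fun _ _ => rfl
        map_smul' := fun _ _ => rfl }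
    refine hβ _ (shortExact_ker f' hf')
      { τ₁ := ModuleCat.ofHom g ≫ ModuleCat.ofHom (Submodule.subtype _)
        τ₂ := ModuleCat.ofHom (Submodule.subtype _)
        τ₃ := ModuleCat.ofHom (Submodule.subtype _)
        comm₁₂ := rfl
        comm₂₃ := rfl } ?_
    rw [← Ext.mk₀_comp_mk₀_assoc, hr, Ext.comp_zero]

/-- the inverse system of the `S/I^t` -/
noncomputable abbrev Q (I : Ideal S) : ℕᵒᵖ ⥤ ModuleCat.{0} S :=
  localCohomology.ringModIdeals (localCohomology.idealPowersDiagram I)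

/-- Vanishing of `colim Ext^i(S/I^t, M)`. -/
def W (I : Ideal S) (M : ModuleCat.{0} S) (i : ℕ) : Prop :=
  ∀ (t : ℕ) (α : Ext ((Q I).obj (op t)) M i), ∃ (t' : ℕ) (h : t ≤ t'),
    (Ext.mk₀ ((Q I).map (homOfLE h).op)).comp α (zero_add i) = 0

lemma W_of_iso {I : Ideal S} {M N : ModuleCat.{0} S} (e : M ≅ N) {i : ℕ} (h : W I M i) :
    W I N i := by
  intro t α
  obtain ⟨t', ht, h⟩ := h t (α.comp (Ext.mk₀ e.inv) (add_zero i))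
  refine ⟨t', ht, ?_⟩
  have := congrArg (fun β => Ext.comp β (Ext.mk₀ e.hom) (add_zero i)) h
  simpa [Ext.comp_assoc_of_third_deg_zero] using this

lemma W_of_exact {I : Ideal S} {A : ShortComplex (ModuleCat.{0} S)} (hA : A.ShortExact) {i : ℕ}
    (h1 : W I A.X₁ i) (h3 : W I A.X₃ i) : W I A.X₂ i := by
  intro t α
  obtain ⟨t', ht, h⟩ := h3 t (α.comp (Ext.mk₀ A.g) (add_zero i))
  rw [← Ext.comp_assoc_of_third_deg_zero] at h
  obtain ⟨β, hβ⟩ := Ext.covariant_sequence_exact₂ _ hA _ h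
  obtain ⟨t'', ht', h'⟩ := h1 t' β
  refine ⟨t'', ht.trans ht', ?_⟩
  rw [← homOfLE_comp ht ht', op_comp, Functor.map_comp, ← Ext.mk₀_comp_mk₀_assoc, ← hβ,
    ← Ext.comp_assoc_of_third_deg_zero, h', Ext.zero_comp]

lemma W_of_killed [IsNoetherianRing S] {I : Ideal S} {M : ModuleCat.{0} S}
    (hM : ∀ x ∈ I, ∀ y : M, x • y = 0) (i : ℕ) : W I M (i + 1) := by
  intro t α
  have : Projective (ModuleCat.of S S) := 
      (IsProjective.iff_projective (R := S) S).1 inferInstance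
  have hex : ∀ t : ℕ, (ShortComplex.mk (ModuleCat.ofHom (I ^ t).subtype)
      (ModuleCat.ofHom (Submodule.mkQ (I ^ t)))
      (by ext x; exact (Submodule.Quotient.mk_eq_zero (I ^ t)).2 x.2)).ShortExact := fun t =>
    { exact := by
        rw [ShortComplex.ShortExact.moduleCat_exact_iff_function_exact]
        exact LinearMap.exact_subtype_mkQ _
      mono_f := (ModuleCat.mono_iff_injective _).2 (Submodule.subtype_injective _)
      epi_g := (ModuleCat.epi_iff_surjective _).2 (Submodule.mkQ_surjective _) }
  obtain ⟨β, hβ⟩ := exists_shift (hex t) (M := M) α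
  obtain ⟨s, hs⟩ := exists_restrict_zero I M hM i _ β
  refine ⟨s + t, by lia, ?_⟩
  have hle : I ^ (s + t) ≤ I ^ t := Ideal.pow_le_pow_right (by lia)
  have key : ∀ x : ↥(I ^ (s + t)), (⟨x.1, hle x.2⟩ : ↥(I ^ t)) ∈
      (I ^ s • ⊤ : Submodule S ↥(I ^ t)) := by
    intro x
    have h2 : x.1 ∈ (I ^ s • ⊤ : Submodule S ↥(I ^ t)).map (Submodule.subtype (I ^ t)) := by
      rw [Submodule.map_smul'', Submodule.map_top, Submodule.range_subtype, smul_eq_mul, ← pow_add]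
      exact x.2
    obtain ⟨z, hz, hzx⟩ := h2
    exact (Subtype.ext hzx : z = ⟨x.1, hle x.2⟩) ▸ hz
  let g : ↥(I ^ (s + t)) →ₗ[S] (I ^ s • ⊤ : Submodule S ↥(I ^ t)) :=
      { toFun := fun x => ⟨_, key x⟩
        map_add' := fun _ _ => rfl
        map_smul' := fun _ _ => rfl }
  refine hβ _ (hex (s + t))
      { τ₁ := ModuleCat.ofHom g ≫ ModuleCat.ofHom (Submodule.subtype _)
        τ₂ := 𝟙 _
        τ₃ := (Q I).map (homOfLE (by lia : t ≤ s + t)).op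
        comm₁₂ := rfl
        comm₂₃ := rfl } ?_
  rw [← Ext.mk₀_comp_mk₀_assoc, hs, Ext.comp_zero]

lemma W_of_regular {I : Ideal S} {A : ShortComplex (ModuleCat.{0} S)} (hA : A.ShortExact)
    (x : S) (hx : x ∈ I) (e : A.X₁ ≅ A.X₂) (he : A.f = x • e.hom)
    {i : ℕ} (h : W I A.X₃ i) : W I A.X₁ (i + 1) := by
  have main : ∀ (n t : ℕ) (α : Ext ((Q I).obj (op t)) A.X₁ (i + 1)), x ^ n • α = 0 →
      ∃ (t' : ℕ) (h : t ≤ t'),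
        (Ext.mk₀ ((Q I).map (homOfLE h).op)).comp α (zero_add (i + 1)) = 0 := by
    intro n
    induction n with
    | zero =>
      intro t α h0
      refine ⟨t, le_rfl, ?_⟩
      rw [pow_zero, one_smul] at h0
      rw [h0, Ext.comp_zero]
    | succ n ih =>
      intro t α h0
      obtain ⟨t', ht, h1⟩ := ih t (x • α) (by rw [smul_smul, ← pow_succ, h0])
      have h2 : ((Ext.mk₀ ((Q I).map (homOfLE ht).op)).comp α (zero_add (i + 1))).comp
          (Ext.mk₀ A.f) (add_zero _) = 0 := by
        rw [he, Ext.mk₀_smul, Ext.comp_smul, ← Ext.smul_comp, ← Ext.comp_smul, h1, Ext.zero_comp]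
      obtain ⟨γ, hγ⟩ := Ext.covariant_sequence_exact₁ _ hA _ h2 rfl
      obtain ⟨t'', ht', h3⟩ := h t' γ
      refine ⟨t'', ht.trans ht', ?_⟩
      rw [← homOfLE_comp ht ht', op_comp, Functor.map_comp, ← Ext.mk₀_comp_mk₀_assoc, ← hγ,
        ← Ext.comp_assoc (a₁₂ := i) _ _ _ (by lia) (by lia) (by lia), h3, Ext.zero_comp]
  intro t α
  refine main t t α ?_
  have h1 : x ^ t • α = (x ^ t • Ext.mk₀ (𝟙 ((Q I).obj (op t)))).comp α (zero_add _) := by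
    rw [Ext.smul_comp, Ext.mk₀_id_comp]
  have h2 : x ^ t • 𝟙 ((Q I).obj (op t)) = 0 := by
    ext y
    obtain ⟨y, rfl⟩ := Submodule.mkQ_surjective (I ^ t) y
    change x ^ t • Submodule.mkQ (I ^ t) y = 0
    rw [← map_smul, Submodule.mkQ_apply, Submodule.Quotient.mk_eq_zero]
    exact Ideal.mul_mem_right _ _ (Ideal.pow_mem_pow hx t)
  rw [h1, ← Ext.mk₀_smul, h2, Ext.mk₀_zero, Ext.zero_comp]


lemma W_main [IsNoetherianRing S] [IsLocalRing S] (d : ℕ) :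
    ∀ (M : Type) [AddCommGroup M] [Module S M] [Module.Finite S M],
      ringKrullDim (S ⧸ Module.annihilator S M) < (d : WithBot (WithTop ℕ)) →
      ∀ i, d ≤ i → W (IsLocalRing.maximalIdeal S) (ModuleCat.of S M) i := by
  have hsub : ∀ (M : Type) [AddCommGroup M] [Module S M] [Subsingleton M] (i : ℕ),
      W (IsLocalRing.maximalIdeal S) (ModuleCat.of S M) i := by
    intro M _ _ _ i t α
    refine ⟨t, le_rfl, ?_⟩
    have h1 : 𝟙 (ModuleCat.of S M) = 0 := by
      ext x
      exact Subsingleton.elim (α := M) _ _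
    have h2 : α = 0 := by
      rw [← Ext.comp_mk₀_id α, h1, Ext.mk₀_zero, Ext.comp_zero]
    rw [h2, Ext.comp_zero]
  have hmono : ∀ {J K : Ideal S}, J ≤ K → ringKrullDim (S ⧸ K) ≤ ringKrullDim (S ⧸ J) :=
    fun h => ringKrullDim_le_of_surjective _ (Ideal.Quotient.factor_surjective h)
  induction d with
  | zero =>
    intro M _ _ _ hM i _
    have h1 : Subsingleton (S ⧸ Module.annihilator S M) := by
      by_contra hne
      rw [not_subsingleton_iff_nontrivial] at hne
      exact absurd hM (not_lt.2 ringKrullDim_nonneg_of_nontrivial)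
    rw [Ideal.Quotient.subsingleton_iff, Module.annihilator_eq_top_iff] at h1
    exact hsub M i
  | succ d ih =>
    intro M _ _ hfin
    induction hfin using IsNoetherianRing.induction_on_isQuotientEquivQuotientPrime S with
    | subsingleton N => exact fun _ i _ => hsub N i
    | exact N₁ N₂ N₃ f g hf hg hfg h₁ h₃ =>
      intro hd i hi
      have hA : (ModuleCat.shortComplexOfCompEqZero f g hfg.linearMap_comp_eq_zero).ShortExact :=
        { exact := ModuleCat.shortComplex_exact _ hfg
          mono_f := (ModuleCat.mono_iff_injective _).2 hf
          epi_g := (ModuleCat.epi_iff_surjective _).2 hg }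
      exact W_of_exact hA
        (h₁ ((hmono (LinearMap.annihilator_le_of_injective f hf)).trans_lt hd) i hi)
        (h₃ ((hmono (LinearMap.annihilator_le_of_surjective g hg)).trans_lt hd) i hi)
    | quotient N p e =>
      intro hd i hi
      obtain ⟨i, rfl⟩ : ∃ j, i = j + 1 := ⟨i - 1, by lia⟩
      rw [e.annihilator_eq, Ideal.annihilator_quotient] at hd
      refine W_of_iso e.toModuleIso.symm ?_
      have hp := p.2
      by_cases hpm : p.1 = IsLocalRing.maximalIdeal S
      · refine W_of_killed (fun x hx y => ?_) i
        obtain ⟨y, rfl⟩ := Submodule.mkQ_surjective p.1 y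
        change x • Submodule.mkQ p.1 y = 0
        rw [← map_smul, Submodule.mkQ_apply, Submodule.Quotient.mk_eq_zero, hpm]
        exact Ideal.mul_mem_right _ _ hx
      · obtain ⟨x, hx, hxp⟩ := SetLike.exists_of_lt
          (lt_of_le_of_ne (IsLocalRing.le_maximalIdeal hp.ne_top) hpm)
        let f : (S ⧸ p.1) →ₗ[S] (S ⧸ p.1) := x • LinearMap.id
        let g : (S ⧸ p.1) →ₗ[S] ((S ⧸ p.1) ⧸ LinearMap.range f) := Submodule.mkQ _
        have hxne : (Ideal.Quotient.mk p.1 x) ≠ 0 := by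
          rwa [Ne, Ideal.Quotient.eq_zero_iff_mem]
        have hf : Function.Injective f := by
          rw [← LinearMap.ker_eq_bot, LinearMap.ker_eq_bot']
          intro y hy
          have : Ideal.Quotient.mk p.1 x * y = 0 := by
            rw [← Ideal.Quotient.algebraMap_eq, ← Algebra.smul_def]; exact hy
          exact (mul_eq_zero.1 this).resolve_left hxne
        have hA : (ModuleCat.shortComplexOfCompEqZero f g
            (LinearMap.range_mkQ_comp f)).ShortExact :=
          { exact := ModuleCat.shortComplex_exact _ (LinearMap.exact_map_mkQ_range f)
            mono_f := (ModuleCat.mono_iff_injective _).2 hf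
            epi_g := (ModuleCat.epi_iff_surjective _).2 (Submodule.mkQ_surjective _) }
        refine W_of_regular hA x hx (Iso.refl _) rfl (ih _ ?_ i (by lia))
        have h1 := ringKrullDim_quotient_succ_le_of_nonZeroDivisor
          (mem_nonZeroDivisors_of_ne_zero hxne)
        have h2 : ringKrullDim (S ⧸ Module.annihilator S ((S ⧸ p.1) ⧸ LinearMap.range f)) ≤
            ringKrullDim ((S ⧸ p.1) ⧸ Ideal.span {Ideal.Quotient.mk p.1 x}) := by
          have h3 : Ideal.span {Ideal.Quotient.mk p.1 x} =
              (Ideal.span {x}).map (Ideal.Quotient.mk p.1) := by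
            rw [Ideal.map_span, Set.image_singleton]
          rw [h3, ringKrullDim_eq_of_ringEquiv (DoubleQuot.quotQuotEquivQuotSup _ _)]
          refine hmono (sup_le (fun y hy => ?_) ?_)
          · rw [Module.mem_annihilator]
            intro z
            obtain ⟨z, rfl⟩ := Submodule.mkQ_surjective _ z
            obtain ⟨z, rfl⟩ := Submodule.mkQ_surjective p.1 z
            rw [← map_smul, ← map_smul]
            have h5 : Submodule.mkQ p.1 (y • z) = 0 :=
              (Submodule.Quotient.mk_eq_zero p.1).2 (Ideal.mul_mem_right _ _ hy)
            rw [h5, map_zero]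
          · rw [Ideal.span_singleton_le_iff_mem, Module.mem_annihilator]
            intro z
            obtain ⟨z, rfl⟩ := Submodule.mkQ_surjective _ z
            rw [← map_smul, Submodule.mkQ_apply, Submodule.Quotient.mk_eq_zero]
            exact ⟨z, rfl⟩
        refine h2.trans_lt (lt_of_not_ge fun h => ?_)
        refine absurd (((add_le_add_left h 1).trans h1).trans_lt hd) ?_
        push_cast
        exact lt_irrefl _


/-- The bridge between the two definitions of `Ext`. -/
lemma old_ext_map_eq_zero {X M : ModuleCat.{0} S} (n : ℕ)
    (α : ((_root_.Ext S (ModuleCat.{0} S) n).obj (op X)).obj M) :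
    ∃ (P : ProjectiveResolution X) (f : P.complex.X n ⟶ M) (_ : P.complex.d (n + 1) n ≫ f = 0),
    ∀ (X' : ModuleCat.{0} S) (g : X' ⟶ X) (P' : ProjectiveResolution X')
      (φ : ProjectiveResolution.Hom P' P g),
      ((∃ u : P'.complex.X (n - 1) ⟶ M, P'.complex.d n (n - 1) ≫ u = φ.hom.f n ≫ f)) →
    (((_root_.Ext S (ModuleCat.{0} S) n).map g.op).app M).hom α = 0 := by
  let F := ((linearYoneda S (ModuleCat.{0} S)).obj M).rightOp
  let P := ProjectiveResolution.of X
  let K := (F.mapHomologicalComplex (ComplexShape.down ℕ)).obj P.complex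
  -- α lives in `((F.leftDerived n).obj X).unop`
  let eX : (F.leftDerived n).obj X ≅ K.homology n := P.isoLeftDerivedObj F n
  have hs : Function.Surjective (eX.hom ≫ K.homologyι n).unop.hom := by
    rw [← ModuleCat.epi_iff_surjective]
    infer_instance
  obtain ⟨z, hz⟩ := hs α
  have hcoc : P.complex.d (n + 1) n ≫ ((K.pOpcycles n).unop.hom z : P.complex.X n ⟶ M) = 0 := by
    have := congrArg (fun h => h.unop.hom z) (K.d_pOpcycles (n + 1) n)
    exact this
  refine ⟨P, (K.pOpcycles n).unop.hom z, hcoc, ?_⟩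
  rintro X' g P' φ ⟨u, hu⟩
  let K' := (F.mapHomologicalComplex (ComplexShape.down ℕ)).obj P'.complex
  let ψ : K' ⟶ K := (F.mapHomologicalComplex (ComplexShape.down ℕ)).map φ.hom
  let eX' : (F.leftDerived n).obj X' ≅ K'.homology n := P'.isoLeftDerivedObj F n
  have hmap : (F.leftDerived n).map g ≫ eX.hom = eX'.hom ≫ HomologicalComplex.homologyMap ψ n := by
    refine ProjectiveResolution.isoLeftDerivedObj_hom_naturality g P' P φ.hom ?_ F n
    simpa using φ.hom_f_zero_comp_π_f_zero
  have hinj : Function.Injective (K'.homologyπ n ≫ eX'.inv).unop.hom := by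
    rw [← ModuleCat.mono_iff_injective]
    infer_instance
  apply hinj
  subst hz
  refine Eq.trans ?_ (map_zero _).symm
  have e1 : (K'.homologyπ n ≫ eX'.inv) ≫ (F.leftDerived n).map g ≫ (eX.hom ≫ K.homologyι n) =
      K'.iCycles n ≫ ψ.f n ≫ K.pOpcycles n := by
    rw [reassoc_of% hmap]
    simp
  have e2 : ψ.f n = (F.map (φ.hom.f n)) := rfl
  have e3 := congrArg (fun h => h.unop.hom z) e1
  refine Eq.trans e3 ?_
  have e4 : (ψ.f n).unop.hom ((K.pOpcycles n).unop.hom z) = (K'.d n (n - 1)).unop.hom u := hu.symm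
  change (K'.iCycles n).unop.hom ((ψ.f n).unop.hom ((K.pOpcycles n).unop.hom z)) = 0
  rw [e4]
  exact congrArg (fun h => h.unop.hom u) (K'.iCycles_d n (n - 1))


lemma subsingleton_of_W (I : Ideal S) (M : ModuleCat.{0} S) (i : ℕ) (h : W I M i)
    (h0 : i = 0 → Subsingleton M) : Subsingleton ((localCohomology I i).obj M) := by
  let D := localCohomology.diagram (localCohomology.idealPowersDiagram I) i
  let c : Cocone (D ⋙ (evaluation _ _).obj M) :=
    ((evaluation (ModuleCat.{0} S) (ModuleCat.{0} S)).obj M).mapCocone (colimit.cocone D)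
  have hc : IsColimit c := isColimitOfPreserves _ (colimit.isColimit D)
  refine subsingleton_of_forall_eq 0 fun y => ?_
  obtain ⟨j, α, hα⟩ := Concrete.isColimit_exists_rep _ hc y
  obtain ⟨P, f, hf, hP⟩ := old_ext_map_eq_zero (X := (Q I).obj j.unop) i α
  obtain ⟨t', ht, hz⟩ := h j.unop.unop (P.extMk f (i + 1) rfl hf)
  let g := (Q I).map (homOfLE ht).op
  let P' := ProjectiveResolution.of ((Q I).obj (op t'))
  let φ : ProjectiveResolution.Hom P' P g :=
    { hom := ProjectiveResolution.lift g P' P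
      hom_f_zero_comp_π_f_zero := by
        rw [← HomologicalComplex.comp_f, ProjectiveResolution.lift_commutes]
        rfl }
  have hzero := hP _ g P' φ (by
    rcases i with _ | i
    · have := h0 rfl
      refine ⟨0, ?_⟩
      ext x
      exact Subsingleton.elim (α := M) _ _
    · rw [ProjectiveResolution.mk₀_comp_extMk f (i + 2) rfl hf φ,
        ProjectiveResolution.extMk_eq_zero_iff _ _ _ _ _ i rfl] at hz
      exact hz)
  have hw := c.w ((homOfLE ht).op.op : j ⟶ op (op t'))
  have hw' := congrArg (fun k => k.hom α) hw
  rw [← hα]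
  refine Eq.trans hw'.symm ?_
  refine Eq.trans (congrArg (c.ι.app (op (op t'))).hom hzero) (map_zero _)

end LCVanish

/-- Grothendieck vanishing: for a Noetherian local ring `(S, 𝔪)` and a finitely
generated `S`-module `M`, the local cohomology `H^i_𝔪(M)` vanishes for `i > dim M`,
where `dim M` is the Krull dimension of `S/ann(M)` (the dimension of the support). -/
theorem localCohomology_subsingleton_of_gt_dim
    {S : Type} [CommRing S] [IsNoetherianRing S] [IsLocalRing S]
    (M : Type) [AddCommGroup M] [Module S M] [Module.Finite S M]
    (i : ℕ) (hi : ringKrullDim (S ⧸ Module.annihilator S M) < (i : WithBot (WithTop ℕ))) :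
    Subsingleton ((localCohomology (IsLocalRing.maximalIdeal S) i).obj (ModuleCat.of S M)) := by
  have hW := LCVanish.W_main i M hi i le_rfl
  refine LCVanish.subsingleton_of_W _ _ i hW ?_
  rintro rfl
  have h1 : Subsingleton (S ⧸ Module.annihilator S M) := by
    by_contra hne
    rw [not_subsingleton_iff_nontrivial] at hne
    exact absurd hi (not_lt.2 ringKrullDim_nonneg_of_nontrivial)
  rw [Ideal.Quotient.subsingleton_iff, Module.annihilator_eq_top_iff] at h1
  exact h1
end

section
/- Let R = K⟦x₁,…,x_n⟧ over a field K, S = R⟦x_{n+1}⟧, and G(M) = M ⊗_R (S_{x_{n+1}}/S). Then an R-module M is injective if and only if the S-module G(M) is injective. -/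
set_option synthInstance.maxHeartbeats 1000000
set_option maxHeartbeats 1000000

open TensorProduct PowerSeries


section Kash
variable {R : Type} [CommRing R]

theorem kash_split (s : PowerSeries R) :
    ∃ s' : PowerSeries R, s = PowerSeries.C (PowerSeries.constantCoeff s) + s' * X := by
  have h : (X : PowerSeries R) ∣ s - PowerSeries.C (PowerSeries.constantCoeff s) := by
    rw [PowerSeries.X_dvd_iff]; simp
  obtain ⟨s', hs'⟩ := h
  exact ⟨s', by rw [mul_comm, ← hs']; ring⟩

section general
variable {M : Type} [AddCommGroup M] [Module R M]
  {N : Type} [AddCommGroup N] [Module R N] [Module (PowerSeries R) N]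
  [IsScalarTower R (PowerSeries R) N]
  (c : N ≃ₗ[R] (ℕ →₀ M))

theorem kash_coeff
    (hc : ∀ y i, c ((X : PowerSeries R) • y) i = c y (i + 1))
    (k : ℕ) : ∀ y i, c ((X : PowerSeries R) ^ k • y) i = c y (i + k) := by
  induction k with
  | zero => simp
  | succ k ih =>
    intro y i
    rw [pow_succ', mul_smul, hc, ih]
    congr 1; omega

theorem kash_C (r : R) (y : N) : (PowerSeries.C r : PowerSeries R) • y = r • y := by
  rw [← algebraMap_smul (PowerSeries R) r y]; rfl

theorem kash_backward
    (hc : ∀ y i, c ((X : PowerSeries R) • y) i = c y (i + 1))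
    (h : Module.Baer (PowerSeries R) N) : Module.Baer R M := by
  intro I f
  have hX : ∀ m, (X : PowerSeries R) • c.symm (Finsupp.single 0 m) = 0 := by
    intro m
    apply c.injective
    ext i
    rw [hc]; simp
  have hs : ∀ (s : PowerSeries R) m, s • c.symm (Finsupp.single 0 m) =
      c.symm (Finsupp.single 0 (PowerSeries.constantCoeff s • m)) := by
    intro s m
    obtain ⟨s', hs'⟩ := kash_split s
    conv_lhs => rw [hs', add_smul, mul_smul, hX, smul_zero, add_zero, kash_C]
    rw [← map_smul, Finsupp.smul_single]
  let J : Ideal (PowerSeries R) := I.comap PowerSeries.constantCoeff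
  let g : J →ₗ[PowerSeries R] N :=
    { toFun := fun s => c.symm (Finsupp.single 0 (f ⟨PowerSeries.constantCoeff s.1, s.2⟩))
      map_add' := by
        intro a b
        rw [← map_add, ← Finsupp.single_add, ← map_add]
        congr 3
      map_smul' := by
        intro a b
        rw [RingHom.id_apply, hs, ← map_smul]
        congr 3
        ext; simp }
  obtain ⟨g', hg'⟩ := h J g
  have hX1 : (X : PowerSeries R) • g' 1 = 0 := by
    rw [← map_smul, smul_eq_mul, mul_one, hg' X (by simp [J])]
    have : (⟨PowerSeries.constantCoeff (X : PowerSeries R), by simp⟩ : I) = 0 := by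
      ext; simp
    change c.symm (Finsupp.single 0 (f ⟨PowerSeries.constantCoeff (X : PowerSeries R), _⟩)) = 0
    rw [this]; simp
  refine ⟨LinearMap.toSpanSingleton R M (c (g' 1) 0), ?_⟩
  intro r hr
  rw [LinearMap.toSpanSingleton_apply]
  have h1 := hg' (PowerSeries.C r) (by simpa [J] using hr)
  have h2 : g' (PowerSeries.C r) = r • g' 1 := by
    rw [← kash_C, ← map_smul]; simp
  rw [h2] at h1
  have h3 := congrArg (fun z => c z 0) h1
  simp only [map_smul, Finsupp.smul_apply] at h3
  rw [h3]
  change c (c.symm (Finsupp.single 0 (f ⟨PowerSeries.constantCoeff (PowerSeries.C r : PowerSeries R), _⟩))) 0 = _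
  rw [LinearEquiv.apply_symm_apply, Finsupp.single_eq_same]
  congr 1

theorem kash_nilp
    (hc : ∀ y i, c ((X : PowerSeries R) • y) i = c y (i + 1))
    (y : N) : ∃ k : ℕ, ∀ k' ≥ k, (X : PowerSeries R) ^ k' • y = 0 := by
  refine ⟨(c y).support.sup id + 1, fun k' hk => ?_⟩
  apply c.injective
  ext i
  rw [kash_coeff c hc]
  simp only [map_zero, Finsupp.coe_zero, Pi.zero_apply]
  by_contra hne
  have := Finset.le_sup (f := id) (Finsupp.mem_support_iff.2 hne)
  simp only [id] at this
  omega

theorem kash_forward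
    (hc : ∀ y i, c ((X : PowerSeries R) • y) i = c y (i + 1))
    [IsNoetherianRing R] (h : Module.Injective R M) :
    Module.Baer (PowerSeries R) N := by
  intro J f
  -- uniform bound
  obtain ⟨k, hk⟩ : ∃ k : ℕ, ∀ j, (X : PowerSeries R) ^ k • f j = 0 := by
    obtain ⟨T, hT⟩ := (inferInstance : Module.Finite (PowerSeries R) J).fg_top
    choose κ hκ using fun j => kash_nilp c hc (f j)
    refine ⟨T.sup κ, fun j => ?_⟩
    have hj : j ∈ Submodule.span (PowerSeries R) (T : Set J) := by rw [hT]; trivial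
    induction hj using Submodule.span_induction with
    | mem x hx => exact hκ x _ (Finset.le_sup hx)
    | zero => simp
    | add x y _ _ hx hy => rw [map_add, smul_add, hx, hy, add_zero]
    | smul a x _ hx => rw [map_smul, smul_comm, hx, smul_zero]
  obtain ⟨n, hn⟩ := Ideal.exists_pow_inf_eq_pow_smul (Ideal.span {(X : PowerSeries R)}) J
  have hn := hn (n + k) (by omega)
  have hAR : ∀ j : J, (X : PowerSeries R) ^ (n + k) ∣ j.1 → f j = 0 := by
    intro j hj
    have h1 : j.1 ∈ (Ideal.span {(X : PowerSeries R)} ^ (n + k) • ⊤ : Ideal (PowerSeries R)) ⊓ J := by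
      refine ⟨?_, j.2⟩
      rw [Ideal.span_singleton_pow, smul_eq_mul, Ideal.mul_top]
      exact Ideal.mem_span_singleton.2 hj
    rw [hn, Ideal.span_singleton_pow, Submodule.ideal_span_singleton_smul,
      Submodule.mem_smul_pointwise_iff_exists] at h1
    obtain ⟨b, hb, hbj⟩ := h1
    have : j = (X : PowerSeries R) ^ k • (⟨b, hb.2⟩ : J) := by
      ext1
      rw [← hbj]
      simp
    rw [this, map_smul, hk]
  generalize n + k = m at hAR
  clear hn hk
  let t : PowerSeries R →ₗ[R] (Fin m → R) := LinearMap.pi fun i => PowerSeries.coeff (i : ℕ)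
  have ht : ∀ s, t s = 0 ↔ (X : PowerSeries R) ^ m ∣ s := by
    intro s
    rw [PowerSeries.X_pow_dvd_iff]
    constructor
    · intro h i hi
      exact congrFun h ⟨i, hi⟩
    · intro h
      ext i
      exact h i i.2
  let tJ : J →ₗ[R] (Fin m → R) := t ∘ₗ (J.subtype.restrictScalars R)
  let φ : N →ₗ[R] M := Finsupp.lapply 0 ∘ₗ c.toLinearMap
  have hφ : ∀ y, φ y = c y 0 := fun y => rfl
  let g : J →ₗ[R] M := φ ∘ₗ f.restrictScalars R
  have hker : LinearMap.ker tJ ≤ LinearMap.ker g := by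
    intro j hj
    rw [LinearMap.mem_ker] at hj ⊢
    have := hAR j ((ht _).1 hj)
    change φ (f j) = 0
    rw [this, map_zero]
  obtain ⟨η, hη⟩ := h.out ((LinearMap.ker tJ).liftQ tJ le_rfl)
    (LinearMap.ker_eq_bot.1 (Submodule.ker_liftQ_eq_bot _ _ _ le_rfl))
    ((LinearMap.ker tJ).liftQ g hker)
  have hη' : ∀ j : J, η (t j.1) = c (f j) 0 := fun j => hη (Submodule.Quotient.mk j)
  let y0 : N := c.symm (∑ i ∈ Finset.range m, Finsupp.single i (η (t (X ^ i))))
  have hy0 : ∀ i, c y0 i = η (t (X ^ i)) := by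
    intro i
    simp only [y0, LinearEquiv.apply_symm_apply, Finsupp.finsetSum_apply, Finsupp.single_apply]
    rw [Finset.sum_ite_eq' (Finset.range m) i]
    split_ifs with hi
    · rfl
    · rw [(ht _).2 (pow_dvd_pow _ (by simpa using hi)), map_zero]
  have hmy0 : (X : PowerSeries R) ^ m • y0 = 0 := by
    apply c.injective
    ext i
    rw [kash_coeff c hc, hy0, (ht _).2 (pow_dvd_pow _ (by omega))]
    simp
  have key : ∀ s : PowerSeries R, c (s • y0) 0 = η (t s) := by
    intro s
    have hd : (X : PowerSeries R) ^ m ∣ s - ∑ i ∈ Finset.range m, PowerSeries.coeff i s • X ^ i := by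
      rw [PowerSeries.X_pow_dvd_iff]
      intro i hi
      simp [PowerSeries.coeff_X_pow, hi]
    obtain ⟨s', hs'⟩ := hd
    have hs : s = ∑ i ∈ Finset.range m, PowerSeries.coeff i s • X ^ i + s' * X ^ m := by
      rw [mul_comm, ← hs']; ring
    rw [hs, add_smul, mul_smul, hmy0, smul_zero, add_zero, map_add t,
      (ht (s' * X ^ m)).2 (Dvd.intro_left _ rfl), add_zero, Finset.sum_smul]
    simp only [map_sum, map_smul, smul_assoc, Finsupp.finsetSum_apply, Finsupp.smul_apply]
    refine Finset.sum_congr rfl fun i _ => ?_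
    rw [kash_coeff c hc, zero_add, hy0]
  refine ⟨LinearMap.toSpanSingleton (PowerSeries R) N y0, ?_⟩
  intro s hs
  rw [LinearMap.toSpanSingleton_apply]
  apply c.injective
  ext i
  have h1 := kash_coeff c hc i (s • y0) 0
  have h2 := kash_coeff c hc i (f ⟨s, hs⟩) 0
  rw [zero_add] at h1 h2
  rw [← h1, ← h2, ← map_smul f, ← mul_smul, key, ← hη']
  rfl

end general

section basis
variable {Q : Type} [AddCommGroup Q] [Module (PowerSeries R) Q] [Module R Q]
  [IsScalarTower R (PowerSeries R) Q]
  (e : ℕ → Q)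

theorem kash_li (he0 : (X : PowerSeries R) • e 0 = 0)
    (hes : ∀ i, (X : PowerSeries R) • e (i + 1) = e i)
    (hinj : ∀ r : R, r • e 0 = 0 → r = 0) : LinearIndependent R e := by
  have main : ∀ (n : ℕ) (g : ℕ → R), ∑ i ∈ Finset.range n, g i • e i = 0 → ∀ i < n, g i = 0 := by
    intro n
    induction n with
    | zero => intro g _ i hi; omega
    | succ n ih =>
      intro g hg
      have h1 : ∀ i < n, g (i + 1) = 0 := by
        apply ih
        have := congrArg (fun z => (X : PowerSeries R) • z) hg
        simp only [smul_zero] at this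
        rw [Finset.sum_range_succ', smul_add, smul_comm, he0, smul_zero, add_zero,
          Finset.smul_sum] at this
        rw [← this]
        refine Finset.sum_congr rfl fun i _ => ?_
        rw [smul_comm, hes]
      rw [Finset.sum_range_succ', Finset.sum_eq_zero, zero_add] at hg
      · intro i hi
        cases i with
        | zero => exact hinj _ hg
        | succ i => exact h1 i (by omega)
      · intro i hi
        rw [h1 i (by simpa using hi), zero_smul]
  rw [linearIndependent_iff'']
  intro s g hs hsum i
  by_cases hi : i ∈ s
  · refine main (s.sup id + 1) g ?_ i (Nat.lt_succ_of_le (Finset.le_sup (f := id) hi))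
    rw [← hsum]
    symm
    apply Finset.sum_subset
    · intro j hj
      exact Finset.mem_range.2 (Nat.lt_succ_of_le (Finset.le_sup (f := id) hj))
    · intro j _ hj
      rw [hs j hj, zero_smul]
  · exact hs i hi

theorem kash_span (he0 : (X : PowerSeries R) • e 0 = 0)
    (hes : ∀ i, (X : PowerSeries R) • e (i + 1) = e i)
    (hsp : ∀ q : Q, q = 0 ∨ ∃ (s : PowerSeries R) (i : ℕ), q = s • e i) :
    ⊤ ≤ Submodule.span R (Set.range e) := by
  have main : ∀ i (s : PowerSeries R), s • e i ∈ Submodule.span R (Set.range e) := by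
    intro i
    induction i with
    | zero =>
      intro s
      obtain ⟨s', hs'⟩ := kash_split s
      rw [hs', add_smul, mul_smul, he0, smul_zero, add_zero, kash_C]
      exact Submodule.smul_mem _ _ (Submodule.subset_span ⟨0, rfl⟩)
    | succ i ih =>
      intro s
      obtain ⟨s', hs'⟩ := kash_split s
      rw [hs', add_smul, mul_smul, hes, kash_C]
      exact Submodule.add_mem _ (Submodule.smul_mem _ _ (Submodule.subset_span ⟨i + 1, rfl⟩)) (ih s')
  intro q _
  rcases hsp q with rfl | ⟨s, i, rfl⟩
  · exact Submodule.zero_mem _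
  · exact main i s

theorem kash_tensor (M : Type) [AddCommGroup M] [Module R M] (b : Module.Basis ℕ R Q)
    (hb0 : (X : PowerSeries R) • b 0 = 0)
    (hbs : ∀ i, (X : PowerSeries R) • b (i + 1) = b i) (y : Q ⊗[R] M) (i : ℕ) :
    TensorProduct.equivFinsuppOfBasisLeft b ((X : PowerSeries R) • y) i =
      TensorProduct.equivFinsuppOfBasisLeft b y (i + 1) := by
  have hq : ∀ q : Q, b.repr ((X : PowerSeries R) • q) i = b.repr q (i + 1) := by
    intro q
    have : (b.coord i) ∘ₗ ((LinearMap.lsmul (PowerSeries R) Q X).restrictScalars R)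
        = b.coord (i + 1) := by
      apply b.ext
      intro j
      cases j with
      | zero => simp [hb0]
      | succ j => simp [hbs, Finsupp.single_apply]
    exact LinearMap.congr_fun this q
  induction y using TensorProduct.induction_on with
  | zero => simp
  | tmul q m =>
    rw [TensorProduct.smul_tmul', TensorProduct.equivFinsuppOfBasisLeft_apply_tmul_apply,
      TensorProduct.equivFinsuppOfBasisLeft_apply_tmul_apply, hq]
  | add x y hx hy => simp only [smul_add, map_add (TensorProduct.equivFinsuppOfBasisLeft b), Finsupp.add_apply, hx, hy]

end basis

section exists_basis
variable {Q : Type} [AddCommGroup Q] [Module (PowerSeries R) Q] [Module R Q]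
  [IsScalarTower R (PowerSeries R) Q]

theorem kash_exists_basis
    (π : Localization.Away (X : PowerSeries R) →ₗ[PowerSeries R] Q)
    (hπ : Function.Surjective π)
    (hker : LinearMap.ker π = LinearMap.range (Algebra.linearMap
      (PowerSeries R) (Localization.Away (X : PowerSeries R)))) :
    ∃ b : Module.Basis ℕ R Q, (X : PowerSeries R) • b 0 = 0 ∧
      ∀ i, (X : PowerSeries R) • b (i + 1) = b i := by
  let u : Localization.Away (X : PowerSeries R) := IsLocalization.Away.invSelf (X : PowerSeries R)
  have hu : algebraMap (PowerSeries R) (Localization.Away (X : PowerSeries R)) X * u = 1 :=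
    IsLocalization.Away.mul_invSelf _
  have hXu : ∀ i, (X : PowerSeries R) • u ^ (i + 1) = u ^ i := by
    intro i
    rw [Algebra.smul_def, pow_succ', ← mul_assoc, hu, one_mul]
  have hker' : ∀ s : PowerSeries R, π (algebraMap _ _ s) = 0 := by
    intro s
    rw [← LinearMap.mem_ker, hker]
    exact ⟨s, rfl⟩
  have hinjalg : Function.Injective
      (algebraMap (PowerSeries R) (Localization.Away (X : PowerSeries R))) := by
    apply IsLocalization.injective _ (M := Submonoid.powers (X : PowerSeries R))
    rw [Submonoid.powers_le, mem_nonZeroDivisors_iff_right]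
    intro s hs
    ext i
    have := congrArg (PowerSeries.coeff (i + 1)) hs
    simpa [PowerSeries.coeff_succ_mul_X] using this
  let e : ℕ → Q := fun i => π (u ^ (i + 1))
  have he0 : (X : PowerSeries R) • e 0 = 0 := by
    simp only [e]
    rw [← map_smul, hXu, pow_zero, ← map_one (algebraMap (PowerSeries R) _), hker']
  have hes : ∀ i, (X : PowerSeries R) • e (i + 1) = e i := by
    intro i
    simp only [e]
    rw [← map_smul, hXu]
  have hinj : ∀ r : R, r • e 0 = 0 → r = 0 := by
    intro r hr
    simp only [e] at hr
    rw [← kash_C, ← map_smul, ← LinearMap.mem_ker, hker] at hr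
    obtain ⟨s, hs⟩ := hr
    have h1 := congrArg (fun z => (X : PowerSeries R) • z) hs
    simp only [Algebra.linearMap_apply] at h1
    rw [smul_comm, hXu, pow_zero, Algebra.smul_def, Algebra.smul_def, mul_one, ← map_mul] at h1
    have h2 := congrArg PowerSeries.constantCoeff (hinjalg h1)
    simpa using h2.symm
  have hsp : ∀ q : Q, q = 0 ∨ ∃ (s : PowerSeries R) (i : ℕ), q = s • e i := by
    intro q
    obtain ⟨l, rfl⟩ := hπ q
    obtain ⟨⟨s, ⟨_, k, rfl⟩⟩, hs⟩ :=
      IsLocalization.surj (Submonoid.powers (X : PowerSeries R)) l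
    have hl : l = s • u ^ k := by
      rw [Algebra.smul_def, ← hs, mul_assoc]
      simp only [map_pow]
      rw [← mul_pow, hu, one_pow, mul_one]
    cases k with
    | zero =>
      left
      rw [hl, pow_zero, Algebra.smul_def, mul_one, hker']
    | succ k =>
      right
      exact ⟨s, k, by rw [hl, map_smul]⟩
  refine ⟨Module.Basis.mk (kash_li e he0 hes hinj) (kash_span e he0 hes hsp), ?_, ?_⟩
  · simpa using he0
  · intro i; simpa using hes i

end exists_basis
end Kash

/-- Let `R = K⟦x₁,…,xₙ⟧`, `S = R⟦x⟧`, and `Q = S_x/S` (presented as a quotient of the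
localization `L = S_x` by the image of `S`).  An `R`-module `M` is injective if and only
if the `S`-module `G(M) = Q ⊗_R M` is injective. -/
theorem injective_iff_kashiwara_injective
    {K : Type} [Field K] (n : ℕ)
    (Q : Type) [AddCommGroup Q]
    [Module (PowerSeries (MvPowerSeries (Fin n) K)) Q]
    [Module (MvPowerSeries (Fin n) K) Q]
    [IsScalarTower (MvPowerSeries (Fin n) K) (PowerSeries (MvPowerSeries (Fin n) K)) Q]
    (π : Localization.Away (X : PowerSeries (MvPowerSeries (Fin n) K))
      →ₗ[PowerSeries (MvPowerSeries (Fin n) K)] Q)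
    (hπ : Function.Surjective π)
    (hker : LinearMap.ker π = LinearMap.range (Algebra.linearMap
      (PowerSeries (MvPowerSeries (Fin n) K))
      (Localization.Away (X : PowerSeries (MvPowerSeries (Fin n) K)))))
    (M : Type) [AddCommGroup M] [Module (MvPowerSeries (Fin n) K) M] :
    Module.Injective (MvPowerSeries (Fin n) K) M ↔
      Module.Injective (PowerSeries (MvPowerSeries (Fin n) K))
        (Q ⊗[MvPowerSeries (Fin n) K] M) := by
  obtain ⟨b, hb0, hbs⟩ := kash_exists_basis π hπ hker
  have hc := kash_tensor M b hb0 hbs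
  constructor
  · intro h
    exact (kash_forward (TensorProduct.equivFinsuppOfBasisLeft b) hc h).injective
  · intro h
    exact (kash_backward (TensorProduct.equivFinsuppOfBasisLeft b) hc
      (Module.Baer.of_injective h)).injective
end

section
/- Let R = K⟦x₁,…,x_n⟧ over a field K, S = R⟦x_{n+1}⟧, and G(M) = M ⊗_R (S_{x_{n+1}}/S). Then for every ideal I ⊆ R and every j ∈ ℕ, G(H^j_I(M)) ≅ H^{j+1}_{(I, x_{n+1})S}(M ⊗_R S). -/
set_option synthInstance.maxHeartbeats 1000000
set_option maxHeartbeats 1000000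

open TensorProduct PowerSeries CategoryTheory

namespace KLC
open HomologicalComplex

variable {R : Type} [CommRing R]

/-- covariance of the Hom complex -/
noncomputable def yMap (P : ChainComplex (ModuleCat.{0} R) ℕ) {Y Y' : ModuleCat.{0} R} (u : Y ⟶ Y') :
    P.linearYonedaObj R Y ⟶ P.linearYonedaObj R Y' where
  f n := ((linearYoneda R (ModuleCat.{0} R)).map u).app (Opposite.op (P.X n))
  comm' i j _ := ((linearYoneda R (ModuleCat.{0} R)).map u).naturality (P.d j i).op |>.symm

/-- contravariance of the Hom complex -/
noncomputable def xMap {P P' : ChainComplex (ModuleCat.{0} R) ℕ} (φ : P ⟶ P') (Y : ModuleCat.{0} R) :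
    P'.linearYonedaObj R Y ⟶ P.linearYonedaObj R Y where
  f n := ((linearYoneda R (ModuleCat.{0} R)).obj Y).map (φ.f n).op
  comm' i j _ := by
    change ((linearYoneda R (ModuleCat.{0} R)).obj Y).map (φ.f i).op ≫
      ((linearYoneda R (ModuleCat.{0} R)).obj Y).map (P.d j i).op = 
      ((linearYoneda R (ModuleCat.{0} R)).obj Y).map (P'.d j i).op ≫
      ((linearYoneda R (ModuleCat.{0} R)).obj Y).map (φ.f j).op
    rw [← Functor.map_comp, ← Functor.map_comp, ← op_comp, ← op_comp, φ.comm]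

lemma absOp {V : Type*} [Category V] {E E' H H' : Vᵒᵖ} {h h' : V} (a : E ≅ H) (a' : E' ≅ H')
    (b : H ≅ Opposite.op h) (b' : H' ≅ Opposite.op h') (m : H' ⟶ H) (μ : h ⟶ h')
    (hm : m ≫ b.hom = b'.hom ≫ μ.op) (e : E' ⟶ E) (he : e ≫ a.hom = a'.hom ≫ m) :
    e.unop ≫ (a'.unop.symm ≪≫ b'.unop.symm).hom =
      (a.unop.symm ≪≫ b.unop.symm).hom ≫ μ := by
  have h1 : e = a'.hom ≫ m ≫ a.inv := by rw [← Category.assoc, ← he]; simp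
  have h2 : μ = b.hom.unop ≫ m.unop ≫ b'.inv.unop := by
    apply Quiver.Hom.op_inj
    simp [hm]
  subst h1
  rw [h2]
  apply Quiver.Hom.op_inj
  simp

lemma absComp {V : Type*} [Category V] {A B C D : V} (a : A ⟶ B) (b : B ⟶ C) (c : D ≅ C) :
    (a ≫ b ≫ c.inv) ≫ c.hom = a ≫ b := by simp

lemma isoExt_natY {X : ModuleCat.{0} R} (P : ProjectiveResolution X) (n : ℕ) {Y Y' : ModuleCat.{0} R}
    (u : Y ⟶ Y') :
    ((Ext R (ModuleCat.{0} R) n).obj (Opposite.op X)).map u ≫ (P.isoExt n Y').hom =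
      (P.isoExt n Y).hom ≫ HomologicalComplex.homologyMap (yMap P.complex u) n := by
  refine absOp (P.isoLeftDerivedObj ((linearYoneda R (ModuleCat.{0} R)).obj Y).rightOp n) 
    (P.isoLeftDerivedObj ((linearYoneda R (ModuleCat.{0} R)).obj Y').rightOp n)
    ((P.complex.linearYonedaObj R Y).homologyOp n)
    ((P.complex.linearYonedaObj R Y').homologyOp n) _ _ 
    (HomologicalComplex.homologyOp_hom_naturality (yMap P.complex u) n)
    ((NatTrans.leftDerived (NatTrans.rightOp ((linearYoneda R (ModuleCat.{0} R)).map u)) n).app X) ?_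
  rw [ProjectiveResolution.leftDerived_app_eq _ P]
  exact absComp _ _ _

lemma isoExt_natX {X X' : ModuleCat.{0} R} (P : ProjectiveResolution X) (P' : ProjectiveResolution X')
    (f : X ⟶ X')
    (φ : P.complex ⟶ P'.complex) (comm : φ.f 0 ≫ P'.π.f 0 = P.π.f 0 ≫ f)
    (n : ℕ) (Y : ModuleCat.{0} R) :
    ((Ext R (ModuleCat.{0} R) n).map f.op).app Y ≫ (P.isoExt n Y).hom =
      (P'.isoExt n Y).hom ≫ HomologicalComplex.homologyMap (xMap φ Y) n := by
  refine absOp (P'.isoLeftDerivedObj ((linearYoneda R (ModuleCat.{0} R)).obj Y).rightOp n) 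
    (P.isoLeftDerivedObj ((linearYoneda R (ModuleCat.{0} R)).obj Y).rightOp n)
    ((P'.complex.linearYonedaObj R Y).homologyOp n)
    ((P.complex.linearYonedaObj R Y).homologyOp n) _ _ 
    (HomologicalComplex.homologyOp_hom_naturality (xMap φ Y) n)
    ((((linearYoneda R (ModuleCat.{0} R)).obj Y).rightOp.leftDerived n).map f) ?_
  exact ProjectiveResolution.isoLeftDerivedObj_hom_naturality f P P' φ comm ((linearYoneda R (ModuleCat.{0} R)).obj Y).rightOp n

/-- cocycle class -/
noncomputable def hcls (K : CochainComplex (ModuleCat.{0} R) ℕ) (n : ℕ) :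
    LinearMap.ker (K.d n (n+1)).hom →ₗ[R] K.homology n :=
  (ModuleCat.Hom.hom (K.homologyπ n)).comp (ModuleCat.Hom.hom (K.liftCycles 
    (ModuleCat.ofHom (LinearMap.ker (K.d n (n+1)).hom).subtype) (n+1) (by simp) (by ext x; exact x.2)))

lemma hcls_i (K : CochainComplex (ModuleCat.{0} R) ℕ) (n : ℕ) (z : LinearMap.ker (K.d n (n+1)).hom) :
    (K.iCycles n).hom ((K.liftCycles 
    (ModuleCat.ofHom (LinearMap.ker (K.d n (n+1)).hom).subtype) (n+1) (by simp) (by ext x; exact x.2)).hom z)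
     = z.1 := by
  rw [← LinearMap.comp_apply, ← ModuleCat.hom_comp, HomologicalComplex.liftCycles_i]
  rfl

lemma iCycles_inj (K : CochainComplex (ModuleCat.{0} R) ℕ) (n : ℕ) : Function.Injective (K.iCycles n).hom :=
  (ModuleCat.mono_iff_injective _).1 inferInstance

lemma hcls_surj (K : CochainComplex (ModuleCat.{0} R) ℕ) (n : ℕ) : Function.Surjective (hcls K n) := by
  intro h
  obtain ⟨c, rfl⟩ := (ModuleCat.epi_iff_surjective (K.homologyπ n)).1 inferInstance h
  refine ⟨⟨(K.iCycles n).hom c, ?_⟩, ?_⟩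
  · rw [LinearMap.mem_ker, ← LinearMap.comp_apply, ← ModuleCat.hom_comp, HomologicalComplex.iCycles_d]
    rfl
  · change (K.homologyπ n).hom _ = _
    congr 1
    apply iCycles_inj
    exact hcls_i K n _

lemma hcls_zero (K : CochainComplex (ModuleCat.{0} R) ℕ) (n : ℕ) (z) : hcls K n z = 0 ↔
   ∃ y, (K.d ((ComplexShape.up ℕ).prev n) n).hom y = z.1 := by
  have hex := (ShortComplex.moduleCat_exact_iff _).1
    (ShortComplex.exact_of_g_is_cokernel (ShortComplex.mk (K.toCycles ((ComplexShape.up ℕ).prev n) n)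
      (K.homologyπ n) (by simp)) (K.homologyIsCokernel _ n rfl))
  constructor
  · intro h
    obtain ⟨y, hy⟩ := hex _ h
    refine ⟨y, ?_⟩
    rw [← hcls_i]
    refine Eq.trans ?_ (congrArg (K.iCycles n).hom hy)
    change _ = (K.iCycles n).hom ((K.toCycles _ n).hom y)
    rw [← LinearMap.comp_apply, ← ModuleCat.hom_comp, HomologicalComplex.toCycles_i]
  · rintro ⟨y, hy⟩
    have : (K.liftCycles 
      (ModuleCat.ofHom (LinearMap.ker (K.d n (n+1)).hom).subtype) (n+1) (by simp) (by ext x; exact x.2)).hom z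
      = (K.toCycles ((ComplexShape.up ℕ).prev n) n).hom y := by
      apply iCycles_inj
      refine (hcls_i K n z).trans ?_
      rw [← LinearMap.comp_apply, ← ModuleCat.hom_comp, HomologicalComplex.toCycles_i, hy]
    change (K.homologyπ n).hom _ = _
    refine (congrArg _ this).trans ?_
    rw [← LinearMap.comp_apply, ← ModuleCat.hom_comp, HomologicalComplex.toCycles_comp_homologyπ]
    rfl

lemma hcls_map {K L : CochainComplex (ModuleCat.{0} R) ℕ} (φ : K ⟶ L) (n : ℕ) (z) (w) (h : w.1 = (φ.f n).hom z.1) :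
   (HomologicalComplex.homologyMap φ n).hom (hcls K n z) = hcls L n w := by
  change (HomologicalComplex.homologyMap φ n).hom ((K.homologyπ n).hom _) = (L.homologyπ n).hom _
  rw [← LinearMap.comp_apply, ← ModuleCat.hom_comp, HomologicalComplex.homologyπ_naturality]
  change (L.homologyπ n).hom ((cyclesMap φ n).hom _) = _
  congr 1
  apply iCycles_inj
  refine Eq.trans ?_ (hcls_i L n w).symm
  rw [← LinearMap.comp_apply, ← ModuleCat.hom_comp, HomologicalComplex.cyclesMap_i, h]
  change (φ.f n).hom ((K.iCycles n).hom _) = _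
  congr 1
  exact hcls_i K n z

/-- coboundaries -/
def IsCob (P : ChainComplex (ModuleCat.{0} R) ℕ) {Y : ModuleCat.{0} R} (n : ℕ) (f : P.X n ⟶ Y) : Prop :=
  ∃ g : P.X ((ComplexShape.up ℕ).prev n) ⟶ Y, P.d n _ ≫ g = f

lemma isCob_zero (P : ChainComplex (ModuleCat.{0} R) ℕ) {Y : ModuleCat.{0} R} (f : P.X 0 ⟶ Y) :
    IsCob P 0 f ↔ f = 0 := by
  have h : P.d 0 ((ComplexShape.up ℕ).prev 0) = 0 := P.shape _ _ (by simp)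
  constructor
  · rintro ⟨g, rfl⟩
    rw [h, Limits.zero_comp]
  · rintro rfl
    exact ⟨0, by simp⟩

lemma isCob_succ (P : ChainComplex (ModuleCat.{0} R) ℕ) {Y : ModuleCat.{0} R} (n : ℕ) (f : P.X (n+1) ⟶ Y) :
    IsCob P (n+1) f ↔ ∃ g : P.X n ⟶ Y, P.d (n+1) n ≫ g = f := by
  have h : (ComplexShape.up ℕ).prev (n+1) = n := (ComplexShape.up ℕ).prev_eq' rfl
  unfold IsCob
  rw [h]

/-- class in Ext of a cocycle -/
noncomputable def ecls {X : ModuleCat.{0} R} (P : ProjectiveResolution X) {Y : ModuleCat.{0} R} (n : ℕ)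
    (f : P.complex.X n ⟶ Y) (hf : P.complex.d (n+1) n ≫ f = 0) :
    ((Ext R (ModuleCat.{0} R) n).obj (Opposite.op X)).obj Y :=
  (P.isoExt n Y).inv.hom (hcls (P.complex.linearYonedaObj R Y) n ⟨f, hf⟩)

section
variable {X : ModuleCat.{0} R} (P : ProjectiveResolution X) {Y : ModuleCat.{0} R} (n : ℕ)

lemma ecls_surj (e : ((Ext R (ModuleCat.{0} R) n).obj (Opposite.op X)).obj Y) :
    ∃ f hf, ecls P n f hf = e := by
  obtain ⟨⟨f, hf⟩, h⟩ := hcls_surj _ n ((P.isoExt n Y).hom.hom e)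
  refine ⟨f, hf, ?_⟩
  unfold ecls
  erw [h]
  rw [← LinearMap.comp_apply, ← ModuleCat.hom_comp, Iso.hom_inv_id]
  rfl

lemma ecls_zero (f : P.complex.X n ⟶ Y) (hf) : ecls P n f hf = 0 ↔ IsCob P.complex n f := by
  have h1 : ecls P n f hf = 0 ↔ hcls (P.complex.linearYonedaObj R Y) n ⟨f, hf⟩ = 0 := by
    constructor
    · intro h
      have := congrArg (P.isoExt n Y).hom.hom h
      unfold ecls at this
      rw [← LinearMap.comp_apply, ← ModuleCat.hom_comp, Iso.inv_hom_id, map_zero] at this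
      exact this
    · intro h
      unfold ecls
      rw [h, map_zero]
  rw [h1, hcls_zero]
  rfl

lemma ecls_add (f g : P.complex.X n ⟶ Y) (hf hg) :
    ecls P n (f + g) (by rw [Preadditive.comp_add, hf, hg, add_zero]) = ecls P n f hf + ecls P n g hg := by
  unfold ecls
  rw [← map_add, ← map_add]
  rfl

lemma ecls_smul (r : R) (f : P.complex.X n ⟶ Y) (hf) :
    ecls P n (r • f) (by rw [Linear.comp_smul, hf, smul_zero]) = r • ecls P n f hf := by
  unfold ecls
  rw [← map_smul, ← map_smul]
  rfl

lemma ecls_mapY {Y' : ModuleCat.{0} R} (u : Y ⟶ Y') (f : P.complex.X n ⟶ Y) (hf) :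
    (((Ext R (ModuleCat.{0} R) n).obj (Opposite.op X)).map u).hom (ecls P n f hf) =
      ecls P n (f ≫ u) (by rw [← Category.assoc, hf, Limits.zero_comp]) := by
  have h := isoExt_natY P n u
  rw [← Iso.inv_comp_eq, ← Category.assoc, ← Iso.eq_comp_inv] at h
  unfold ecls
  rw [← LinearMap.comp_apply, ← ModuleCat.hom_comp, h]
  refine congrArg ((P.isoExt n Y').inv.hom) ?_
  exact hcls_map (yMap P.complex u) n ⟨f, hf⟩ ⟨f ≫ u, _⟩ rfl

lemma ecls_mapX {X' : ModuleCat.{0} R} (P' : ProjectiveResolution X')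
    (v : X ⟶ X')
    (φ : P.complex ⟶ P'.complex) (comm : φ.f 0 ≫ P'.π.f 0 = P.π.f 0 ≫ v)
    (f : P'.complex.X n ⟶ Y) (hf) :
    (((Ext R (ModuleCat.{0} R) n).map v.op).app Y).hom (ecls P' n f hf) =
      ecls P n (φ.f n ≫ f) (by rw [← Category.assoc, ← φ.comm, Category.assoc, hf, Limits.comp_zero]) := by
  have h := isoExt_natX P P' v φ comm n Y
  rw [← Iso.inv_comp_eq, ← Category.assoc, ← Iso.eq_comp_inv] at h
  unfold ecls
  rw [← LinearMap.comp_apply, ← ModuleCat.hom_comp, h]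
  refine congrArg ((P.isoExt n Y).inv.hom) ?_
  exact hcls_map (xMap φ Y) n ⟨f, hf⟩ ⟨φ.f n ≫ f, _⟩ rfl

end

section H
open localCohomology Opposite

variable (I : Ideal R)

/-- resolution of `R/I^t` -/
noncomputable def PR (t : ℕ) : ProjectiveResolution (ModuleCat.of R (R ⧸ I ^ t)) :=
  projectiveResolution _

/-- transition map between the quotients -/
noncomputable def tr {t t' : ℕ} (h : t ≤ t') : ModuleCat.of R (R ⧸ I ^ t') ⟶ ModuleCat.of R (R ⧸ I ^ t) :=
  ModuleCat.ofHom <| Submodule.mapQ _ _ LinearMap.id (Ideal.pow_le_pow_right h)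

/-- lift -/
noncomputable def lf {t t' : ℕ} (h : t ≤ t') : (PR I t').complex ⟶ (PR I t).complex :=
  ProjectiveResolution.lift (tr I h) _ _

lemma lf_comm {t t' : ℕ} (h : t ≤ t') : (lf I h).f 0 ≫ (PR I t).π.f 0 = (PR I t').π.f 0 ≫ tr I h :=
  ProjectiveResolution.lift_commutes_zero _ _ _

/-- structure map to the colimit -/
noncomputable def iL (Y : ModuleCat.{0} R) (n t : ℕ) :
    ((Ext R (ModuleCat.{0} R) n).obj (Opposite.op (ModuleCat.of R (R ⧸ I ^ t)))).obj Y →ₗ[R]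
      (localCohomology I n).obj Y :=
  ((Limits.colimit.ι (diagram (idealPowersDiagram I) n) (op (op t))).app Y).hom

/-- class in local cohomology -/
noncomputable def hmk {Y : ModuleCat.{0} R} (n t : ℕ) (f : (PR I t).complex.X n ⟶ Y)
    (hf : (PR I t).complex.d (n+1) n ≫ f = 0) : (localCohomology I n).obj Y :=
  iL I Y n t (ecls (PR I t) n f hf)

variable {Y : ModuleCat.{0} R} (n : ℕ)

/-- colimit property evaluated -/
noncomputable def evalColim : Limits.IsColimit (((evaluation _ _).obj Y).mapCocone (Limits.colimit.cocone
    (diagram (idealPowersDiagram I) n))) :=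
  Limits.isColimitOfPreserves _ (Limits.colimit.isColimit _)

lemma hmk_surj (e : (localCohomology I n).obj Y) : ∃ t f hf, hmk I n t f hf = e := by
  obtain ⟨j, y, hy⟩ := Limits.Concrete.isColimit_exists_rep _ (evalColim I (Y := Y) n) e
  obtain ⟨f, hf, h⟩ := ecls_surj (PR I j.unop.unop) n y
  refine ⟨j.unop.unop, f, hf, ?_⟩
  unfold hmk
  rw [h]
  exact hy

lemma hmk_up {t t' : ℕ} (h : t ≤ t') (f : (PR I t).complex.X n ⟶ Y) (hf) :
    hmk I n t f hf = hmk I n t' ((lf I h).f n ≫ f)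
      (by rw [← Category.assoc, ← (lf I h).comm, Category.assoc, hf, Limits.comp_zero]) := by
  unfold hmk
  rw [← ecls_mapX (PR I t') n (PR I t) (tr I h) (lf I h) (lf_comm I h) f hf]
  have := Limits.colimit.w (diagram (idealPowersDiagram I) n) (j' := op (op t)) (j := op (op t'))
    ((homOfLE h).op.op)
  have h2 := congrArg (fun φ => (φ.app Y).hom (ecls (PR I t) n f hf)) this
  exact h2.symm

lemma hmk_zero (t : ℕ) (f : (PR I t).complex.X n ⟶ Y) (hf) : hmk I n t f hf = 0 ↔
    ∃ t', ∃ h : t ≤ t', IsCob (PR I t').complex n ((lf I h).f n ≫ f) := by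
  constructor
  · intro h
    have h0 : hmk I n t f hf = iL I Y n t 0 := by
      rw [h, map_zero]
    obtain ⟨k, a, b, hab⟩ := Limits.Concrete.isColimit_exists_of_rep_eq _ (evalColim I (Y := Y) n) _ _ h0
    refine ⟨k.unop.unop, leOfHom a.unop.unop, ?_⟩
    rw [← ecls_zero (PR I k.unop.unop) n _ (by
      rw [← Category.assoc, ← (lf I _).comm, Category.assoc, hf, Limits.comp_zero]), ← ecls_mapX (PR I k.unop.unop) n (PR I t) (tr I _) (lf I _) (lf_comm I _) f hf]
    exact hab.trans (map_zero (ModuleCat.Hom.hom _))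
  · rintro ⟨t', h, hc⟩
    rw [hmk_up I n h]
    unfold hmk
    rw [(ecls_zero (PR I t') n _ _).2 hc, map_zero]

lemma hmk_add (t : ℕ) (f g : (PR I t).complex.X n ⟶ Y) (hf hg) :
    hmk I n t (f + g) (by rw [Preadditive.comp_add, hf, hg, add_zero]) = hmk I n t f hf + hmk I n t g hg := by
  unfold hmk
  rw [ecls_add, map_add]

lemma hmk_smul (r : R) (t : ℕ) (f : (PR I t).complex.X n ⟶ Y) (hf) :
    hmk I n t (r • f) (by rw [Linear.comp_smul, hf, smul_zero]) = r • hmk I n t f hf := by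
  unfold hmk
  rw [ecls_smul, map_smul]

lemma hmk_map {Y' : ModuleCat.{0} R} (u : Y ⟶ Y') (t : ℕ) (f : (PR I t).complex.X n ⟶ Y) (hf) :
    ((localCohomology I n).map u).hom (hmk I n t f hf) =
      hmk I n t (f ≫ u) (by rw [← Category.assoc, hf, Limits.zero_comp]) := by
  unfold hmk
  rw [← ecls_mapY]
  have := (Limits.colimit.ι (diagram (idealPowersDiagram I) n) (op (op t))).naturality u
  have h2 := congrArg (fun φ => φ.hom (ecls (PR I t) n f hf)) this
  exact h2.symm

end H

end KLC

namespace KLC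

lemma relIso {R U V : Type*} [CommRing R] [AddCommGroup U] [AddCommGroup V] [Module R U] [Module R V]
    (G : Submodule R (U × V)) (K : Submodule R U) (h1 : ∀ u, ∃ v, (u, v) ∈ G) (h2 : ∀ v, ∃ u, (u, v) ∈ G)
    (h3 : ∀ u v, (u, v) ∈ G → (v = 0 ↔ u ∈ K)) : Nonempty ((U ⧸ K) ≃ₗ[R] V) := by
  let f : G →ₗ[R] V := (LinearMap.snd R U V).comp G.subtype
  let g : G →ₗ[R] (U ⧸ K) := K.mkQ.comp ((LinearMap.fst R U V).comp G.subtype)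
  have hf : Function.Surjective f := fun v => by
    obtain ⟨u, hu⟩ := h2 v
    exact ⟨⟨_, hu⟩, rfl⟩
  have hg : Function.Surjective g := fun q => by
    obtain ⟨u, rfl⟩ := K.mkQ_surjective q
    obtain ⟨v, hv⟩ := h1 u
    exact ⟨⟨_, hv⟩, rfl⟩
  have hk : LinearMap.ker g = LinearMap.ker f := by
    ext ⟨⟨u, v⟩, h⟩
    rw [LinearMap.mem_ker, LinearMap.mem_ker]
    change (Submodule.Quotient.mk u : U ⧸ K) = 0 ↔ v = 0
    rw [Submodule.Quotient.mk_eq_zero, h3 u v h]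
  exact ⟨(g.quotKerEquivOfSurjective hg).symm ≪≫ₗ Submodule.quotEquivOfEq _ _ hk ≪≫ₗ
    f.quotKerEquivOfSurjective hf⟩

variable {R : Type} [CommRing R] (I : Ideal R)

lemma hmk_congr {Y : ModuleCat.{0} R} (n t : ℕ) {f g : (PR I t).complex.X n ⟶ Y} (h : f = g) (hf) :
    hmk I n t f hf = hmk I n t g (h ▸ hf) := by subst h; rfl

lemma hmk_sub {Y : ModuleCat.{0} R} (n t : ℕ) (f g : (PR I t).complex.X n ⟶ Y) (hf hg) :
    hmk I n t (f - g) (by rw [Preadditive.comp_sub, hf, hg, sub_zero]) = hmk I n t f hf - hmk I n t g hg := by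
  rw [eq_sub_iff_add_eq, ← hmk_add]
  exact hmk_congr _ _ _ (by simp) _

section les

/-- compatible pairs computing the connecting map -/
def Rel (S : ShortComplex (ModuleCat.{0} R)) (n t : ℕ) (g : (PR I t).complex.X n ⟶ S.X₂) (a : (PR I t).complex.X (n+1) ⟶ S.X₁) : Prop :=
  a ≫ S.f = (PR I t).complex.d (n+1) n ≫ g

lemma Rel.c1 {S : ShortComplex (ModuleCat.{0} R)} {n t : ℕ} {g : (PR I t).complex.X n ⟶ S.X₂} {a : (PR I t).complex.X (n+1) ⟶ S.X₁}
    (h : Rel I S n t g a) : (PR I t).complex.d (n+1) n ≫ (g ≫ S.g) = 0 := by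
  rw [← Category.assoc, ← h, Category.assoc, S.zero, Limits.comp_zero]

lemma Rel.c2 {S : ShortComplex (ModuleCat.{0} R)} (hS : S.ShortExact) {n t : ℕ} {g : (PR I t).complex.X n ⟶ S.X₂} {a : (PR I t).complex.X (n+1) ⟶ S.X₁}
    (h : Rel I S n t g a) : (PR I t).complex.d (n+1+1) (n+1) ≫ a = 0 := by
  have := hS.mono_f
  rw [← cancel_mono S.f, Category.assoc, h]
  simp

lemma Rel.up {S : ShortComplex (ModuleCat.{0} R)} {n t t' : ℕ} (ht : t ≤ t') {g : (PR I t).complex.X n ⟶ S.X₂} {a : (PR I t).complex.X (n+1) ⟶ S.X₁}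
    (h : Rel I S n t g a) : Rel I S n t' ((lf I ht).f n ≫ g) ((lf I ht).f (n+1) ≫ a) := by
  unfold Rel at *
  rw [Category.assoc, h]
  simp

/-- the graph of the connecting map -/
def relSub (S : ShortComplex (ModuleCat.{0} R)) (hS : S.ShortExact) (n : ℕ) :
    Submodule R ((localCohomology I n).obj S.X₃ × (localCohomology I (n+1)).obj S.X₁) where
  carrier := {z | ∃ t g a, ∃ h : Rel I S n t g a, z.1 = hmk I n t (g ≫ S.g) h.c1 ∧ z.2 = hmk I (n+1) t a (h.c2 I hS)}
  zero_mem' := by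
    refine ⟨0, 0, 0, by simp [Rel], ?_, ?_⟩
    · refine Eq.symm ((hmk_zero I n 0 _ _).2 ⟨0, le_rfl, 0, by simp⟩)
    · refine Eq.symm ((hmk_zero I (n+1) 0 _ _).2 ⟨0, le_rfl, 0, by simp⟩)
  add_mem' := by
    rintro ⟨_, _⟩ ⟨_, _⟩ ⟨t, g, a, h, rfl, rfl⟩ ⟨t', g', a', h', rfl, rfl⟩
    refine ⟨max t t', (lf I (le_max_left t t')).f n ≫ g + (lf I (le_max_right t t')).f n ≫ g',
      (lf I (le_max_left t t')).f (n+1) ≫ a + (lf I (le_max_right t t')).f (n+1) ≫ a', ?_, ?_, ?_⟩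
    · have h1 := h.up I (le_max_left t t')
      have h2 := h'.up I (le_max_right t t')
      unfold Rel at *
      rw [Preadditive.add_comp, Preadditive.comp_add, h1, h2]
    · rw [Prod.fst_add]
      dsimp only
      rw [hmk_up I n (le_max_left t t') (g ≫ S.g), hmk_up I n (le_max_right t t') (g' ≫ S.g), ← hmk_add]
      exact hmk_congr _ _ _ (by simp) _
    · rw [Prod.snd_add]
      dsimp only
      rw [hmk_up I (n+1) (le_max_left t t') a, hmk_up I (n+1) (le_max_right t t') a', ← hmk_add]
  smul_mem' := by
    rintro r ⟨_, _⟩ ⟨t, g, a, h, rfl, rfl⟩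
    refine ⟨t, r • g, r • a, ?_, ?_, ?_⟩
    · unfold Rel at *
      rw [Linear.smul_comp, Linear.comp_smul, h]
    · rw [Prod.smul_fst]
      dsimp only
      rw [← hmk_smul]
      exact hmk_congr _ _ _ (by simp) _
    · rw [Prod.smul_snd]
      dsimp only
      rw [← hmk_smul]

theorem les (S : ShortComplex (ModuleCat.{0} R)) (hS : S.ShortExact) (n : ℕ)
    (hB : ∀ e : (localCohomology I (n+1)).obj S.X₂, e = 0) :
    Nonempty (((localCohomology I n).obj S.X₃ ⧸ LinearMap.range ((localCohomology I n).map S.g).hom)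
      ≃ₗ[R] (localCohomology I (n+1)).obj S.X₁) := by
  have := hS.mono_f
  have := hS.epi_g
  refine relIso (relSub I S hS n) _ ?_ ?_ ?_
  · intro u
    obtain ⟨t, f, hf, rfl⟩ := hmk_surj I n u
    have hg := Projective.factorThru_comp f S.g
    have hz : ((PR I t).complex.d (n+1) n ≫ Projective.factorThru f S.g) ≫ S.g = 0 := by
      rw [Category.assoc, hg, hf]
    have hr : Rel I S n t (Projective.factorThru f S.g) (hS.exact.lift _ hz) := hS.exact.lift_f _ hz
    exact ⟨_, t, _, _, hr, hmk_congr _ _ _ hg.symm _, rfl⟩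
  · intro v
    obtain ⟨t, a, ha, rfl⟩ := hmk_surj I (n+1) v
    obtain ⟨t', h, hc⟩ := (hmk_zero I (n+1) t (a ≫ S.f) (by rw [← Category.assoc, ha, Limits.zero_comp])).1 (hB _)
    rw [isCob_succ] at hc
    obtain ⟨g, hg⟩ := hc
    have hr : Rel I S n t' g ((lf I h).f (n+1) ≫ a) := by
      unfold Rel
      rw [hg, Category.assoc]
    exact ⟨_, t', _, _, hr, rfl, hmk_up _ _ _ _ _⟩
  · rintro _ _ ⟨t, g, a, h, rfl, rfl⟩
    constructor
    · intro hz
      obtain ⟨t', ht, hc⟩ := (hmk_zero I (n+1) t _ _).1 hz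
      rw [isCob_succ] at hc
      obtain ⟨a', ha'⟩ := hc
      have h' := h.up I ht
      have hz' : (PR I t').complex.d (n+1) n ≫ ((lf I ht).f n ≫ g - a' ≫ S.f) = 0 := by
        rw [Preadditive.comp_sub, ← h', ← ha', Category.assoc, sub_self]
      refine ⟨hmk I n t' ((lf I ht).f n ≫ g - a' ≫ S.f) hz', ?_⟩
      rw [hmk_map, hmk_up I n ht]
      exact hmk_congr _ _ _ (by simp) _
    · rintro ⟨e, he⟩
      obtain ⟨t2, b, hb, rfl⟩ := hmk_surj I n e
      rw [hmk_map, hmk_up I n (le_max_right t t2), hmk_up I n (le_max_left t t2), ← sub_eq_zero, ← hmk_sub, hmk_zero] at he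
      obtain ⟨t', ht, c, hc⟩ := he
      rw [hmk_up I (n+1) (le_max_left t t2), hmk_zero]
      refine ⟨t', ht, ?_⟩
      have hr := (h.up I (le_max_left t t2)).up I ht
      generalize hg3 : (lf I ht).f n ≫ (lf I (le_max_left t t2)).f n ≫ g = g3 at *
      generalize ha3 : (lf I ht).f (n+1) ≫ (lf I (le_max_left t t2)).f (n+1) ≫ a = a3 at *
      have hb3 : (PR I t').complex.d (n+1) n ≫ ((lf I ht).f n ≫ (lf I (le_max_right t t2)).f n ≫ b) = 0 := by
        simp [← HomologicalComplex.Hom.comm_assoc, hb]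
      generalize hb3' : (lf I ht).f n ≫ (lf I (le_max_right t t2)).f n ≫ b = b3 at *
      have hc3 : (PR I t').complex.d n _ ≫ c = b3 ≫ S.g - g3 ≫ S.g := by
        rw [hc, ← hb3', ← hg3]
        simp
      have hz : (b3 - g3 - (PR I t').complex.d n _ ≫ Projective.factorThru c S.g) ≫ S.g = 0 := by
        rw [Preadditive.sub_comp, Category.assoc, Projective.factorThru_comp, hc3, Preadditive.sub_comp, sub_self]
      have hl := hS.exact.lift_f _ hz
      rw [isCob_succ]
      refine ⟨-hS.exact.lift _ hz, ?_⟩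
      rw [← cancel_mono S.f]
      unfold Rel at hr
      rw [hr, Category.assoc, Preadditive.neg_comp, hl]
      simp [Preadditive.comp_sub, hb3]

end les

theorem vanish_injective (E : ModuleCat.{0} R) [Injective E] (n : ℕ) (e : (localCohomology I (n+1)).obj E) : e = 0 := by
  obtain ⟨t, f, hf, rfl⟩ := hmk_surj I (n+1) e
  rw [hmk_zero]
  refine ⟨t, le_rfl, ?_⟩
  have hf' : (PR I t).complex.d (n+1+1) (n+1) ≫ ((lf I (le_refl t)).f (n+1) ≫ f) = 0 := by
    simp [← HomologicalComplex.Hom.comm_assoc, hf]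
  rw [isCob_succ]
  exact ⟨((PR I t).exact_succ n).descToInjective _ hf', ((PR I t).exact_succ n).comp_descToInjective _ _⟩

theorem vanish_inv (N : ModuleCat.{0} R) (y : R) (hy : y ∈ I) (v : N ⟶ N) (hv : y • v = 𝟙 N) (n : ℕ)
    (e : (localCohomology I n).obj N) : e = 0 := by
  obtain ⟨t, f, hf, rfl⟩ := hmk_surj I n e
  have hvt : ∃ w : N ⟶ N, y ^ t • w = 𝟙 N := by
    clear hf f
    induction t with
    | zero => exact ⟨𝟙 N, by simp⟩
    | succ k ih =>
      obtain ⟨w, hw⟩ := ih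
      refine ⟨v ≫ w, ?_⟩
      calc y ^ (k+1) • (v ≫ w) = (y • v) ≫ (y ^ k • w) := by
            rw [Linear.smul_comp, Linear.comp_smul, smul_smul, pow_succ']
        _ = 𝟙 N := by rw [hv, hw, Category.comp_id]
  obtain ⟨w, hw⟩ := hvt
  have hz : y ^ t • 𝟙 (ModuleCat.of R (R ⧸ I ^ t)) = 0 := by
    ext
    change y ^ t • (Submodule.Quotient.mk (1 : R) : R ⧸ I ^ t) = 0
    rw [← Submodule.Quotient.mk_smul, Submodule.Quotient.mk_eq_zero, smul_eq_mul, mul_one]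
    exact Ideal.pow_mem_pow hy t
  have hz2 : (y ^ t • 𝟙 (PR I t).complex) ≫ (PR I t).π = 0 := by
    apply HomologicalComplex.to_single_hom_ext
    have h4 : y ^ t • (PR I t).π.f 0 = 0 := by
      have h3 : ∀ p : (PR I t).complex.X 0 ⟶ ModuleCat.of R (R ⧸ I ^ t), y ^ t • p = 0 := fun p => by
        have h5 : p ≫ (y ^ t • 𝟙 (ModuleCat.of R (R ⧸ I ^ t))) = 0 := by rw [hz, Limits.comp_zero]
        rwa [Linear.comp_smul, Category.comp_id] at h5
      exact h3 _
    rw [HomologicalComplex.comp_f, HomologicalComplex.smul_f_apply, Linear.smul_comp, HomologicalComplex.id_f, Category.id_comp]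
    exact h4
  have hh := (ProjectiveResolution.liftHomotopyZero _ hz2).comm n
  rw [hmk_zero]
  refine ⟨t, le_rfl, ?_⟩
  have hf' : (PR I t).complex.d (n+1) n ≫ ((lf I (le_refl t)).f n ≫ f) = 0 := by
    simp [← HomologicalComplex.Hom.comm_assoc, hf]
  generalize (lf I (le_refl t)).f n ≫ f = f' at *
  have key : f' = (y ^ t • 𝟙 (PR I t).complex).f n ≫ f' ≫ w := by
    rw [HomologicalComplex.smul_f_apply, HomologicalComplex.id_f, Linear.smul_comp, Category.id_comp, ← Linear.comp_smul, hw, Category.comp_id]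
  have hf2 : (PR I t).complex.d (n+1) n ≫ f' ≫ w = 0 := by
    rw [← Category.assoc, hf', Limits.zero_comp]
  rw [hh] at key
  cases n with
  | zero =>
    rw [isCob_zero, key]
    rw [Homotopy.dNext_zero_chainComplex, Homotopy.prevD_chainComplex, HomologicalComplex.zero_f, add_zero, zero_add, Category.assoc, hf2, Limits.comp_zero]
  | succ k =>
    rw [isCob_succ]
    rw [Homotopy.dNext_succ_chainComplex, Homotopy.prevD_chainComplex] at key
    rw [HomologicalComplex.zero_f, add_zero, Preadditive.add_comp, Category.assoc, Category.assoc, hf2, Limits.comp_zero, add_zero] at key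
    exact ⟨_, key.symm⟩

end KLC

namespace KLC

section gam
variable {R : Type} [CommRing R] (I : Ideal R)

/-- the augmentation in degree zero -/
noncomputable def pz (t : ℕ) : (PR I t).complex.X 0 ⟶ ModuleCat.of R (R ⧸ I ^ t) := (PR I t).π.f 0

instance pz_epi (t : ℕ) : Epi (pz I t) := inferInstanceAs (Epi ((PR I t).π.f 0))

lemma d_pz (t : ℕ) : (PR I t).complex.d (0+1) 0 ≫ pz I t = 0 := (PR I t).complex_d_comp_π_f_zero

lemma lf_pz {t t' : ℕ} (h : t ≤ t') : (lf I h).f 0 ≫ pz I t = pz I t' ≫ tr I h := lf_comm I h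

lemma pz_desc (t : ℕ) {Y : ModuleCat.{0} R} (f : (PR I t).complex.X 0 ⟶ Y) (hf : (PR I t).complex.d (0+1) 0 ≫ f = 0) :
    ∃ g, pz I t ≫ g = f := by
  have : Epi (ShortComplex.mk _ _ (PR I t).complex_d_comp_π_f_zero).g := inferInstanceAs (Epi ((PR I t).π.f 0))
  exact ⟨(PR I t).exact₀.desc f hf, (PR I t).exact₀.g_desc f hf⟩

/-- the `I`-power torsion submodule -/
def Gam (Y : Type) [AddCommGroup Y] [Module R Y] : Submodule R Y where
  carrier := {m | ∃ t, ∀ a ∈ I ^ t, a • m = 0}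
  zero_mem' := ⟨0, fun a _ => smul_zero a⟩
  add_mem' := by
    rintro m m' ⟨t, h⟩ ⟨t', h'⟩
    refine ⟨max t t', fun a ha => ?_⟩
    rw [smul_add, h a (Ideal.pow_le_pow_right (le_max_left _ _) ha),
      h' a (Ideal.pow_le_pow_right (le_max_right _ _) ha), add_zero]
  smul_mem' := by
    rintro r m ⟨t, h⟩
    refine ⟨t, fun a ha => ?_⟩
    rw [smul_comm, h a ha, smul_zero]

/-- the map `R/I^t → Y` determined by a killed element -/
noncomputable def gq (t : ℕ) (Y : ModuleCat.{0} R) (m : Y) (hm : ∀ a ∈ I ^ t, a • m = 0) :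
    ModuleCat.of R (R ⧸ I ^ t) ⟶ Y :=
  ModuleCat.ofHom (Submodule.liftQ (I ^ t) (LinearMap.toSpanSingleton R Y m) (fun a ha => by
    rw [LinearMap.mem_ker, LinearMap.toSpanSingleton_apply]; exact hm a ha))

lemma gq_one (t : ℕ) (Y : ModuleCat.{0} R) (m : Y) (hm : ∀ a ∈ I ^ t, a • m = 0) :
    (gq I t Y m hm).hom (Submodule.Quotient.mk (1 : R) : R ⧸ I ^ t) = m := by
  change (1 : R) • m = m
  exact one_smul _ _

lemma gq_ext (t : ℕ) {Y : ModuleCat.{0} R} (f g : ModuleCat.of R (R ⧸ I ^ t) ⟶ Y)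
    (h : f.hom (Submodule.Quotient.mk (1 : R) : R ⧸ I ^ t) = g.hom (Submodule.Quotient.mk (1 : R) : R ⧸ I ^ t)) :
    f = g := by
  ext
  exact h

/-- the class in degree zero of a torsion element -/
noncomputable def g0 (t : ℕ) (Y : ModuleCat.{0} R) (m : Y) (hm : ∀ a ∈ I ^ t, a • m = 0) : (localCohomology I 0).obj Y :=
  hmk I 0 t (pz I t ≫ gq I t Y m hm) (by rw [← Category.assoc, d_pz, Limits.zero_comp])

lemma g0_up {t t' : ℕ} (h : t ≤ t') (Y : ModuleCat.{0} R) (m : Y) (hm : ∀ a ∈ I ^ t, a • m = 0) :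
    g0 I t Y m hm = g0 I t' Y m (fun a ha => hm a (Ideal.pow_le_pow_right h ha)) := by
  unfold g0
  rw [hmk_up I 0 h]
  refine hmk_congr _ _ _ ?_ _
  rw [← Category.assoc, lf_pz, Category.assoc]
  congr 1
  apply gq_ext
  rfl

lemma g0_indep {t t' : ℕ} (Y : ModuleCat.{0} R) (m : Y) (hm : ∀ a ∈ I ^ t, a • m = 0) (hm' : ∀ a ∈ I ^ t', a • m = 0) :
    g0 I t Y m hm = g0 I t' Y m hm' := by
  rw [g0_up I (le_max_left t t'), g0_up I (le_max_right t t')]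

/-- torsion elements as degree zero local cohomology classes -/
noncomputable def gamMap (Y : ModuleCat.{0} R) : Gam I Y →ₗ[R] (localCohomology I 0).obj Y where
  toFun m := g0 I m.2.choose Y m.1 m.2.choose_spec
  map_add' m m' := by
    obtain ⟨t, h1⟩ := m.2
    obtain ⟨t', h2⟩ := m'.2
    have e1 : ∀ a ∈ I ^ (max t t'), a • m.1 = 0 := fun a ha => h1 a (Ideal.pow_le_pow_right (le_max_left t t') ha)
    have e2 : ∀ a ∈ I ^ (max t t'), a • m'.1 = 0 := fun a ha => h2 a (Ideal.pow_le_pow_right (le_max_right t t') ha)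
    have e3 : ∀ a ∈ I ^ (max t t'), a • (m + m').1 = 0 := fun a ha => by
      rw [Submodule.coe_add, smul_add, e1 a ha, e2 a ha, add_zero]
    rw [g0_indep I Y m.1 _ e1, g0_indep I Y m'.1 _ e2, g0_indep I Y (m+m').1 _ e3]
    unfold g0
    rw [← hmk_add]
    refine hmk_congr _ _ _ ?_ _
    rw [← Preadditive.comp_add]
    congr 1
    apply gq_ext
    rw [gq_one, ModuleCat.hom_add, LinearMap.add_apply, gq_one, gq_one, Submodule.coe_add]
  map_smul' r m := by
    obtain ⟨t, h1⟩ := m.2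
    have e3 : ∀ a ∈ I ^ t, a • (r • m).1 = 0 := fun a ha => by
      rw [Submodule.coe_smul, smul_comm, h1 a ha, smul_zero]
    rw [g0_indep I Y (r • m).1 _ e3, g0_indep I Y m.1 _ h1]
    unfold g0
    rw [RingHom.id_apply, ← hmk_smul]
    refine hmk_congr _ _ _ ?_ _
    rw [← Linear.comp_smul]
    congr 1
    apply gq_ext
    rw [gq_one, ModuleCat.hom_smul, LinearMap.smul_apply, gq_one, Submodule.coe_smul]

lemma gamMap_eq (Y : ModuleCat.{0} R) (m : Gam I Y) (t : ℕ) (h : ∀ a ∈ I ^ t, a • m.1 = 0) :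
    gamMap I Y m = g0 I t Y m.1 h := g0_indep _ _ _ _ _

lemma gamMap_inj (Y : ModuleCat.{0} R) : Function.Injective (gamMap I Y) := by
  rw [injective_iff_map_eq_zero]
  intro m hm
  obtain ⟨t, ht⟩ := m.2
  rw [gamMap_eq I Y m t ht, g0, hmk_zero] at hm
  obtain ⟨t', h, hc⟩ := hm
  rw [isCob_zero, ← Category.assoc, lf_pz, Category.assoc] at hc
  have h2 : tr I h ≫ gq I t Y m.1 ht = 0 := by
    rw [← cancel_epi (pz I t'), hc, Limits.comp_zero]
  have h3 := congrArg (fun f => f.hom (Submodule.Quotient.mk (1 : R) : R ⧸ I ^ t')) h2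
  refine Subtype.ext ?_
  rw [← gq_one I t Y m.1 ht]
  exact h3

lemma gamMap_surj (Y : ModuleCat.{0} R) : Function.Surjective (gamMap I Y) := by
  intro e
  obtain ⟨t, f, hf, rfl⟩ := hmk_surj I 0 e
  obtain ⟨g, rfl⟩ := pz_desc I t f hf
  have h : ∀ a ∈ I ^ t, a • (g.hom (Submodule.Quotient.mk (1 : R) : R ⧸ I ^ t)) = 0 := by
    intro a ha
    rw [← map_smul, ← Submodule.Quotient.mk_smul, smul_eq_mul, mul_one, (Submodule.Quotient.mk_eq_zero _).2 ha, map_zero]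
  refine ⟨⟨_, t, h⟩, ?_⟩
  rw [gamMap_eq I Y _ t h]
  refine hmk_congr _ _ _ ?_ _
  congr 1
  apply gq_ext
  rw [gq_one]

/-- restriction of a linear map to torsion -/
def Gam.map {Y Y' : Type} [AddCommGroup Y] [Module R Y] [AddCommGroup Y'] [Module R Y'] (u : Y →ₗ[R] Y') : Gam I Y →ₗ[R] Gam I Y' :=
  u.restrict (fun m hm => by
    obtain ⟨t, h⟩ := hm
    exact ⟨t, fun a ha => by rw [← map_smul, h a ha, map_zero]⟩)

lemma gamMap_nat {Y Y' : ModuleCat.{0} R} (u : Y ⟶ Y') (m : Gam I Y) :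
    ((localCohomology I 0).map u).hom (gamMap I Y m) = gamMap I Y' (Gam.map I u.hom m) := by
  obtain ⟨t, ht⟩ := m.2
  have h2 : ∀ a ∈ I ^ t, a • (Gam.map I u.hom m).1 = 0 := fun a ha => by
    change a • u.hom m.1 = 0
    rw [← map_smul, ht a ha, map_zero]
  rw [gamMap_eq I Y m t ht, gamMap_eq I Y' _ t h2, g0, hmk_map]
  refine hmk_congr _ _ _ ?_ _
  rw [Category.assoc]
  congr 1
  apply gq_ext
  rw [gq_one, ModuleCat.hom_comp, LinearMap.comp_apply, gq_one]
  rfl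

/-- degree zero local cohomology is torsion -/
noncomputable def gamEquiv (Y : ModuleCat.{0} R) : Gam I Y ≃ₗ[R] (localCohomology I 0).obj Y :=
  LinearEquiv.ofBijective (gamMap I Y) ⟨gamMap_inj I Y, gamMap_surj I Y⟩

/-- degree one local cohomology via an embedding into an acyclic module -/
theorem les0 (S : ShortComplex (ModuleCat.{0} R)) (hS : S.ShortExact)
    (hB : ∀ e : (localCohomology I (0+1)).obj S.X₂, e = 0) :
    Nonempty ((Gam I S.X₃ ⧸ LinearMap.range (Gam.map I S.g.hom)) ≃ₗ[R] (localCohomology I (0+1)).obj S.X₁) := by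
  obtain ⟨e⟩ := les I S hS 0 hB
  refine ⟨Submodule.Quotient.equiv _ _ (gamEquiv I S.X₃) ?_ ≪≫ₗ e⟩
  ext x
  simp only [Submodule.mem_map, LinearMap.mem_range]
  constructor
  · rintro ⟨_, ⟨m, rfl⟩, rfl⟩
    exact ⟨gamEquiv I _ m, gamMap_nat I S.g m⟩
  · rintro ⟨y, rfl⟩
    obtain ⟨m, rfl⟩ := (gamEquiv I S.X₂).surjective y
    exact ⟨_, ⟨m, rfl⟩, (gamMap_nat I S.g m).symm⟩

/-- dimension shift -/
theorem lesS (S : ShortComplex (ModuleCat.{0} R)) (hS : S.ShortExact) (n : ℕ)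
    (hB0 : ∀ e : (localCohomology I n).obj S.X₂, e = 0)
    (hB : ∀ e : (localCohomology I (n+1)).obj S.X₂, e = 0) :
    Nonempty ((localCohomology I n).obj S.X₃ ≃ₗ[R] (localCohomology I (n+1)).obj S.X₁) := by
  obtain ⟨e⟩ := les I S hS n hB
  have h : LinearMap.range ((localCohomology I n).map S.g).hom = ⊥ := by
    rw [LinearMap.range_eq_bot]
    ext x
    rw [hB0 x, map_zero, map_zero]
  exact ⟨(Submodule.quotEquivOfEqBot _ h).symm ≪≫ₗ e⟩

end gam

end KLC

namespace KLC

section coords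
variable {R : Type} [CommRing R] {Q : Type} [AddCommGroup Q] [Module R⟦X⟧ Q] [Module R Q] [IsScalarTower R R⟦X⟧ Q]

/-- a basis on which `X` acts as the backwards shift -/
structure QB (b : Module.Basis ℕ R Q) : Prop where
  zero : (X : R⟦X⟧) • b 0 = 0
  succ : ∀ i, (X : R⟦X⟧) • b (i+1) = b i

variable {b : Module.Basis ℕ R Q} (hb : QB b) {M : Type} [AddCommGroup M] [Module R M]

include hb in
lemma repr_X (q : Q) (i : ℕ) : b.repr ((X : R⟦X⟧) • q) i = b.repr q (i+1) := by
  let f : Q →ₗ[R] R := (Finsupp.lapply i).comp (b.repr.toLinearMap.comp ((LinearMap.lsmul R⟦X⟧ Q (X : R⟦X⟧)).restrictScalars R))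
  let g : Q →ₗ[R] R := (Finsupp.lapply (i+1)).comp b.repr.toLinearMap
  have h : f = g := by
    apply b.ext
    intro k
    change b.repr ((X : R⟦X⟧) • b k) i = b.repr (b k) (i+1)
    cases k with
    | zero => rw [hb.zero]; simp
    | succ k => rw [hb.succ]; simp [Finsupp.single_apply]
  exact congrArg (fun φ => φ q) h

variable (b) in
/-- coordinates of a tensor -/
noncomputable def co (M : Type) [AddCommGroup M] [Module R M] : Q ⊗[R] M ≃ₗ[R] (ℕ →₀ M) := TensorProduct.equivFinsuppOfBasisLeft b

lemma co_tmul (q : Q) (m : M) (i : ℕ) : co b M (q ⊗ₜ m) i = b.repr q i • m :=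
  TensorProduct.equivFinsuppOfBasisLeft_apply_tmul_apply b q m i

include hb in
lemma co_X (z : Q ⊗[R] M) (i : ℕ) : co b M ((X : R⟦X⟧) • z) i = co b M z (i+1) := by
  induction z with
  | zero => simp
  | add x y hx hy => rw [smul_add, map_add, (co b M).map_add x y, Finsupp.add_apply, Finsupp.add_apply, hx, hy]
  | tmul q m => rw [TensorProduct.smul_tmul', co_tmul, co_tmul, repr_X hb]

include hb in
lemma co_Xpow (z : Q ⊗[R] M) (k i : ℕ) : co b M ((X : R⟦X⟧) ^ k • z) i = co b M z (i+k) := by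
  induction k generalizing i with
  | zero => simp
  | succ k ih => rw [pow_succ', mul_smul, co_X hb, ih]; congr 1; omega

include hb in
lemma Xpow_kill (z : Q ⊗[R] M) : ∃ k, (X : R⟦X⟧) ^ k • z = 0 := by
  obtain ⟨k, hk⟩ := (co b M z).support.exists_nat_subset_range
  refine ⟨k, (co b M).injective ?_⟩
  ext i
  rw [co_Xpow hb, map_zero, Finsupp.zero_apply]
  by_contra h
  have := Finset.mem_range.1 (hk (Finsupp.mem_support_iff.2 h))
  omega

lemma co_lT {M' : Type} [AddCommGroup M'] [Module R M'] (f : M →ₗ[R] M') (z : Q ⊗[R] M) (i : ℕ) :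
    co b M' (AlgebraTensorModule.lTensor R⟦X⟧ Q f z) i = f (co b M z i) := by
  induction z with
  | zero => simp
  | add x y hx hy => rw [map_add, map_add, map_add, Finsupp.add_apply, Finsupp.add_apply, hx, hy, map_add]
  | tmul q m => rw [AlgebraTensorModule.lTensor_tmul, co_tmul, co_tmul, map_smul]

lemma co_C (r : R) (z : Q ⊗[R] M) (i : ℕ) : co b M ((algebraMap R R⟦X⟧ r) • z) i = r • co b M z i := by
  rw [algebraMap_smul, map_smul, Finsupp.smul_apply]

/-- the ideal `(I, X)` -/
noncomputable abbrev JJ (I : Ideal R) : Ideal R⟦X⟧ := Ideal.map (algebraMap R R⟦X⟧) I ⊔ Ideal.span {(X : R⟦X⟧)}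

include hb in
lemma gam_iff (I : Ideal R) (z : Q ⊗[R] M) : z ∈ Gam (JJ I) (Q ⊗[R] M) ↔ ∀ i, co b M z i ∈ Gam I M := by
  constructor
  · rintro ⟨t, ht⟩ i
    refine ⟨t, fun a ha => ?_⟩
    rw [← co_C, ht, map_zero, Finsupp.zero_apply]
    have h1 : algebraMap R R⟦X⟧ a ∈ Ideal.map (algebraMap R R⟦X⟧) I ^ t := by
      rw [← Ideal.map_pow]
      exact Ideal.mem_map_of_mem _ ha
    exact Ideal.pow_right_mono le_sup_left t h1
  · intro h
    obtain ⟨k, hk⟩ := Xpow_kill hb z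
    choose t ht using h
    let T := (Finset.range k).sup t
    have hT : ∀ a ∈ I ^ T, algebraMap R R⟦X⟧ a • z = 0 := by
      intro a ha
      apply (co b M).injective
      ext i
      rw [co_C, map_zero, Finsupp.zero_apply]
      by_cases hi : i < k
      · exact ht i a (Ideal.pow_le_pow_right (Finset.le_sup (f := t) (Finset.mem_range.2 hi)) ha)
      · have := co_Xpow hb z k (i - k)
        rw [hk, map_zero, Finsupp.zero_apply, Nat.sub_add_cancel (by omega)] at this
        rw [← this, smul_zero]
    refine ⟨T + k, fun a ha => ?_⟩
    have h2 : JJ I ^ (T + k) ≤ LinearMap.ker (LinearMap.toSpanSingleton R⟦X⟧ _ z) := by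
      refine Ideal.sup_pow_add_le_pow_sup_pow.trans (sup_le ?_ ?_)
      · rw [← Ideal.map_pow, Ideal.map, Ideal.span_le]
        rintro _ ⟨c, hc, rfl⟩
        exact hT c hc
      · rw [Ideal.span_singleton_pow, Ideal.span_le, Set.singleton_subset_iff]
        exact hk
    exact h2 ha

include hb in
lemma lT_inj {M' : Type} [AddCommGroup M'] [Module R M'] (f : M →ₗ[R] M') (hf : Function.Injective f) :
    Function.Injective (AlgebraTensorModule.lTensor R⟦X⟧ Q f) := by
  intro x y h
  apply (co b M).injective
  ext i
  apply hf
  rw [← co_lT, ← co_lT, h]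

include hb in
lemma gam_range (I : Ideal R) :
    LinearMap.range (AlgebraTensorModule.lTensor R⟦X⟧ Q (Gam I M).subtype) = Gam (JJ I) (Q ⊗[R] M) := by
  ext z
  rw [gam_iff hb]
  constructor
  · rintro ⟨y, rfl⟩ i
    rw [co_lT]
    exact (co b _ y i).2
  · intro h
    have hz : z = (co b M z).sum (fun i n => b i ⊗ₜ n) := by
      rw [← TensorProduct.equivFinsuppOfBasisLeft_symm_apply]
      exact ((co b M).symm_apply_apply z).symm
    rw [hz]
    refine Submodule.sum_mem _ (fun i _ => ?_)
    exact ⟨b i ⊗ₜ ⟨_, h i⟩, rfl⟩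

/-- torsion commutes with the tensor product -/
noncomputable def gamT (I : Ideal R) (M : Type) [AddCommGroup M] [Module R M] : (Q ⊗[R] Gam I M) ≃ₗ[R⟦X⟧] Gam (JJ I) (Q ⊗[R] M) :=
  (LinearEquiv.ofInjective _ (lT_inj hb (Gam I M).subtype (Gam I M).injective_subtype)).trans (LinearEquiv.ofEq _ _ (gam_range hb I))

lemma gamT_coe (I : Ideal R) (y : Q ⊗[R] Gam I M) : (gamT hb I M y).1 = AlgebraTensorModule.lTensor R⟦X⟧ Q (Gam I M).subtype y := rfl

lemma gamT_nat {M' : Type} [AddCommGroup M'] [Module R M'] (f : M →ₗ[R] M') (I : Ideal R) (y : Q ⊗[R] Gam I M) :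
    gamT hb I M' (AlgebraTensorModule.lTensor R⟦X⟧ Q (Gam.map I f) y) =
      Gam.map (JJ I) (AlgebraTensorModule.lTensor R⟦X⟧ Q f) (gamT hb I M y) := by
  apply Subtype.ext
  change _ = AlgebraTensorModule.lTensor R⟦X⟧ Q f (gamT hb I M y).1
  rw [gamT_coe, gamT_coe, ← LinearMap.comp_apply, ← LinearMap.comp_apply, ← AlgebraTensorModule.lTensor_comp, ← AlgebraTensorModule.lTensor_comp]
  rfl

include hb in
/-- comparison of cokernels -/
theorem gamCoker {M' : Type} [AddCommGroup M'] [Module R M'] (f : M →ₗ[R] M') (I : Ideal R) :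
    Nonempty ((Q ⊗[R] (Gam I M' ⧸ LinearMap.range (Gam.map I f))) ≃ₗ[R⟦X⟧]
      (Gam (JJ I) (Q ⊗[R] M') ⧸ LinearMap.range (Gam.map (JJ I) (AlgebraTensorModule.lTensor R⟦X⟧ Q f)))) := by
  let φ := AlgebraTensorModule.lTensor R⟦X⟧ Q (LinearMap.range (Gam.map I f)).mkQ
  have hφ : Function.Surjective φ := LinearMap.lTensor_surjective Q (Submodule.mkQ_surjective _)
  have hex : Function.Exact (AlgebraTensorModule.lTensor R⟦X⟧ Q (Gam.map I f)) φ :=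
    lTensor_exact Q (f := Gam.map I f) (g := (LinearMap.range (Gam.map I f)).mkQ)
      (LinearMap.exact_map_mkQ_range _) (Submodule.mkQ_surjective _)
  refine ⟨(φ.quotKerEquivOfSurjective hφ).symm ≪≫ₗ Submodule.Quotient.equiv _ _ (gamT hb I M') ?_⟩
  rw [hex.linearMap_ker_eq]
  ext x
  simp only [Submodule.mem_map, LinearMap.mem_range]
  constructor
  · rintro ⟨_, ⟨y, rfl⟩, rfl⟩
    exact ⟨_, (gamT_nat hb f I y).symm⟩
  · rintro ⟨y, rfl⟩
    obtain ⟨y, rfl⟩ := (gamT hb I M).surjective y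
    exact ⟨_, ⟨y, rfl⟩, gamT_nat hb f I y⟩

lemma ps_zero {E : Type} [AddCommGroup E] [Module R E] (φ : R⟦X⟧ →ₗ[R] E) (m : ℕ) (h : ∀ k, φ (X ^ k) = 0)
    (hm : ∀ s, φ (X ^ m * s) = 0) : φ = 0 := by
  induction m with
  | zero => ext s; simpa using hm s
  | succ m ih =>
    apply ih
    intro s
    obtain ⟨s', hs'⟩ : ∃ s', s = algebraMap R R⟦X⟧ (constantCoeff s) + X * s' :=
      ⟨_, by rw [add_comm]; exact eq_X_mul_shift_add_const s⟩
    rw [hs', mul_add, ← mul_assoc, ← pow_succ, map_add, hm, add_zero, mul_comm, ← Algebra.smul_def, map_smul, h, smul_zero]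

include hb in
theorem baer [IsNoetherianRing R] (E : Type) [AddCommGroup E] [Module R E] [Module.Injective R E] :
    Module.Baer R⟦X⟧ (Q ⊗[R] E) := by
  intro 𝔞 f
  obtain ⟨s, hs⟩ : ∃ s, ∀ a, (X : R⟦X⟧) ^ s • f a = 0 := by
    let A : ℕ →o Submodule R⟦X⟧ 𝔞 := ⟨fun s => LinearMap.ker ((X : R⟦X⟧) ^ s • f), by
      intro i j hij a ha
      rw [LinearMap.mem_ker, LinearMap.smul_apply] at *
      rw [← Nat.sub_add_cancel hij, pow_add, mul_smul, ha, smul_zero]⟩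
    obtain ⟨n, hn⟩ := monotone_stabilizes_iff_noetherian.2 (inferInstance : IsNoetherian R⟦X⟧ 𝔞) A
    refine ⟨n, fun a => ?_⟩
    obtain ⟨k, hk⟩ := Xpow_kill hb (f a)
    have h1 : a ∈ A k := hk
    have h2 := A.monotone (le_max_right n k) h1
    rw [← hn _ (le_max_left n k)] at h2
    exact h2
  obtain ⟨k, hk⟩ := Ideal.exists_pow_inf_eq_pow_smul (Ideal.span {(X : R⟦X⟧)}) 𝔞
  have hm : ∀ a : 𝔞, (∃ c, a.1 = X ^ (k + s) * c) → f a = 0 := by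
    rintro a ⟨c, hc⟩
    have h1 : a.1 ∈ Ideal.span {(X : R⟦X⟧)} ^ (k+s) • (⊤ : Submodule R⟦X⟧ R⟦X⟧) ⊓ 𝔞 := by
      refine ⟨?_, a.2⟩
      rw [hc, Ideal.span_singleton_pow]
      exact Submodule.smul_mem_smul (Ideal.mem_span_singleton_self _) trivial
    rw [hk _ (Nat.le_add_right k s), Nat.add_sub_cancel_left, Ideal.span_singleton_pow, Submodule.ideal_span_singleton_smul] at h1
    obtain ⟨a', ha', he⟩ := h1
    have h2 : a = (X : R⟦X⟧) ^ s • (⟨a', ha'.2⟩ : 𝔞) := Subtype.ext he.symm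
    rw [h2, map_smul, hs]
  generalize k + s = m at hm
  -- the residue map
  let res : Q ⊗[R] E →ₗ[R] E := (Finsupp.lapply 0).comp (co b E).toLinearMap
  have hres : ∀ z i, co b E z i = res ((X : R⟦X⟧) ^ i • z) := fun z i => by
    change _ = co b E _ 0
    rw [co_Xpow hb, zero_add]
  obtain ⟨g, hg1, hg2⟩ : ∃ g : R⟦X⟧ →ₗ[R] E, (∀ a : 𝔞, g a.1 = res (f a)) ∧ ∀ c, g (X ^ m * c) = 0 := by
    let L : Submodule R R⟦X⟧ := (Ideal.span {(X : R⟦X⟧) ^ m}).restrictScalars R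
    let A : Submodule R R⟦X⟧ := Submodule.restrictScalars R 𝔞
    let ψ : A →ₗ[R] (R⟦X⟧ ⧸ L) := L.mkQ.comp A.subtype
    let f0 : A →ₗ[R] E := res.comp (f.restrictScalars R)
    have hk : LinearMap.ker ψ ≤ LinearMap.ker f0 := by
      intro a ha
      have h1 : a.1 ∈ L := (Submodule.Quotient.mk_eq_zero L).1 ha
      obtain ⟨c, hc⟩ := Ideal.mem_span_singleton.1 h1
      have h2 : f a = 0 := hm a ⟨c, hc⟩
      change res (f a) = 0
      rw [h2, map_zero]
    obtain ⟨h, hh⟩ := Module.Injective.out ((LinearMap.ker ψ).liftQ ψ le_rfl)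
      (LinearMap.ker_eq_bot.1 (Submodule.ker_liftQ_eq_bot _ _ _ le_rfl)) ((LinearMap.ker ψ).liftQ f0 hk)
    refine ⟨h.comp L.mkQ, fun a => hh (Submodule.Quotient.mk a), fun c => ?_⟩
    have h3 : L.mkQ (X ^ m * c) = 0 :=
      (Submodule.Quotient.mk_eq_zero L).2 (Ideal.mem_span_singleton.2 ⟨c, rfl⟩)
    rw [LinearMap.comp_apply, h3, map_zero]
  have hg3 : ∀ i c, m ≤ i → g (X ^ i * c) = 0 := fun i c hi => by
    rw [← Nat.add_sub_cancel' hi, pow_add, mul_assoc, hg2]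
  let F : R⟦X⟧ → Q ⊗[R] E := fun c => (co b E).symm (Finsupp.onFinset (Finset.range m) (fun i => g (X ^ i * c)) (by
    intro i hi
    rw [Finset.mem_range]
    by_contra h
    exact hi (hg3 i c (not_lt.1 h))))
  have hF : ∀ c i, co b E (F c) i = g (X ^ i * c) := fun c i => by
    simp only [F]
    rw [LinearEquiv.apply_symm_apply, Finsupp.onFinset_apply]
  have key : ∀ c s, res (s • F c) = g (s * c) := by
    intro c s
    let φ : R⟦X⟧ →ₗ[R] E := res.comp ((LinearMap.toSpanSingleton R⟦X⟧ _ (F c)).restrictScalars R) -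
      g.comp ((LinearMap.mulRight R⟦X⟧ c).restrictScalars R)
    have hφ : φ = 0 := by
      apply ps_zero φ m
      · intro k
        change res ((X : R⟦X⟧) ^ k • F c) - g (X ^ k * c) = 0
        rw [← hres, hF, sub_self]
      · intro s
        change res (((X : R⟦X⟧) ^ m * s) • F c) - g (X ^ m * s * c) = 0
        have h0 : (X : R⟦X⟧) ^ m • F c = 0 := by
          apply (co b E).injective
          ext i
          rw [co_Xpow hb, hF, hg3 _ _ (Nat.le_add_left m i), map_zero, Finsupp.zero_apply]
        rw [mul_comm, mul_smul, h0, smul_zero, map_zero, mul_comm s, mul_assoc, hg2, sub_zero]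
    exact sub_eq_zero.1 (congrArg (fun φ => φ s) hφ)
  refine ⟨{ toFun := F, map_add' := ?_, map_smul' := ?_ }, ?_⟩
  · intro c d
    apply (co b E).injective
    ext i
    rw [map_add, Finsupp.add_apply, hF, hF, hF, mul_add, map_add]
  · intro s c
    apply (co b E).injective
    ext i
    rw [hF, RingHom.id_apply, hres, smul_smul, key, smul_eq_mul, mul_assoc]
  · intro a ha
    apply (co b E).injective
    ext i
    change co b E (F a) i = _
    rw [hF, hres, ← map_smul, ← hg1]
    rfl

include hb in
theorem inj_tensor [IsNoetherianRing R] (E : Type) [AddCommGroup E] [Module R E] [Module.Injective R E] :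
    Injective (ModuleCat.of R⟦X⟧ (Q ⊗[R] E)) := by
  have : Module.Injective R⟦X⟧ (Q ⊗[R] E) := (baer hb E).injective
  exact Module.injective_object_of_injective_module R⟦X⟧ (Q ⊗[R] E)

/-- exactness of tensoring -/
theorem shortExact (hb : QB b) (T : ShortComplex (ModuleCat.{0} R)) (hT : T.ShortExact) :
    ∃ h, (ShortComplex.mk (X₁ := ModuleCat.of R⟦X⟧ (Q ⊗[R] T.X₁)) (X₂ := ModuleCat.of R⟦X⟧ (Q ⊗[R] T.X₂))
      (X₃ := ModuleCat.of R⟦X⟧ (Q ⊗[R] T.X₃))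
      (ModuleCat.ofHom (AlgebraTensorModule.lTensor R⟦X⟧ Q T.f.hom))
      (ModuleCat.ofHom (AlgebraTensorModule.lTensor R⟦X⟧ Q T.g.hom)) h).ShortExact := by
  have hf : Function.Injective T.f.hom := (ModuleCat.mono_iff_injective _).1 hT.mono_f
  have hg : Function.Surjective T.g.hom := (ModuleCat.epi_iff_surjective _).1 hT.epi_g
  have hex : Function.Exact T.f.hom T.g.hom := (ShortComplex.ShortExact.moduleCat_exact_iff_function_exact T).1 hT.exact
  have hex2 : Function.Exact (AlgebraTensorModule.lTensor R⟦X⟧ Q T.f.hom) (AlgebraTensorModule.lTensor R⟦X⟧ Q T.g.hom) :=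
    lTensor_exact Q hex hg
  refine ⟨?_, ?_⟩
  · apply ModuleCat.hom_ext
    apply LinearMap.ext
    intro x
    exact hex2.apply_apply_eq_zero x
  · refine ShortComplex.ShortExact.mk' ?_ ?_ ?_
    · rw [ShortComplex.ShortExact.moduleCat_exact_iff_function_exact]
      exact hex2
    · rw [ModuleCat.mono_iff_injective]
      exact lT_inj hb _ hf
    · rw [ModuleCat.epi_iff_surjective]
      exact LinearMap.lTensor_surjective Q hg
end coords

end KLC

namespace KLC

section stepB
variable {R : Type} [CommRing R] {Q : Type} [AddCommGroup Q] [Module R⟦X⟧ Q] [Module R Q] [IsScalarTower R R⟦X⟧ Q]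
  {b : Module.Basis ℕ R Q} (hb : QB b)

/-- tensoring an isomorphism -/
noncomputable def tE {A B : Type} [AddCommGroup A] [Module R A] [AddCommGroup B] [Module R B] (e : A ≃ₗ[R] B) :
    (Q ⊗[R] A) ≃ₗ[R⟦X⟧] (Q ⊗[R] B) := AlgebraTensorModule.congr (LinearEquiv.refl R⟦X⟧ Q) e

include hb in
theorem stepB [IsNoetherianRing R] (I : Ideal R) (j : ℕ) (M : ModuleCat.{0} R) :
    Nonempty ((Q ⊗[R] ((localCohomology I j).obj M)) ≃ₗ[R⟦X⟧]
      ((localCohomology (JJ I) j).obj (ModuleCat.of R⟦X⟧ (Q ⊗[R] M)))) := by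
  induction j generalizing M with
  | zero =>
    exact ⟨tE (gamEquiv I M).symm ≪≫ₗ gamT hb I M ≪≫ₗ gamEquiv (JJ I) (ModuleCat.of R⟦X⟧ (Q ⊗[R] M))⟩
  | succ j ih =>
    let T : ShortComplex (ModuleCat.{0} R) := ShortComplex.mk (Injective.ι M) (Limits.cokernel.π _) (Limits.cokernel.condition _)
    have hT : T.ShortExact := ShortComplex.ShortExact.mk' (ShortComplex.exact_cokernel (Injective.ι M))
      (inferInstanceAs (Mono (Injective.ι M))) (inferInstanceAs (Epi (Limits.cokernel.π (Injective.ι M))))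
    have i1 : Injective T.X₂ := inferInstanceAs (Injective (Injective.under M))
    have i2 : Module.Injective R T.X₂ := Module.injective_module_of_injective_object R T.X₂
    have i3 : Injective (ModuleCat.of R⟦X⟧ (Q ⊗[R] T.X₂)) := inj_tensor hb T.X₂
    obtain ⟨h0, hQT⟩ := shortExact hb T hT
    cases j with
    | zero =>
      obtain ⟨e1⟩ := les0 I T hT (vanish_injective I T.X₂ 0)
      obtain ⟨e2⟩ := les0 (JJ I) _ hQT (vanish_injective (JJ I) (ModuleCat.of R⟦X⟧ (Q ⊗[R] T.X₂)) 0)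
      obtain ⟨e3⟩ := gamCoker hb T.g.hom I
      exact ⟨tE e1.symm ≪≫ₗ e3 ≪≫ₗ e2⟩
    | succ j =>
      obtain ⟨e1⟩ := lesS I T hT (j+1) (vanish_injective I T.X₂ j) (vanish_injective I T.X₂ (j+1))
      obtain ⟨e2⟩ := lesS (JJ I) _ hQT (j+1) (vanish_injective (JJ I) (ModuleCat.of R⟦X⟧ (Q ⊗[R] T.X₂)) j)
        (vanish_injective (JJ I) (ModuleCat.of R⟦X⟧ (Q ⊗[R] T.X₂)) (j+1))
      obtain ⟨e3⟩ := ih T.X₃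
      exact ⟨tE e1.symm ≪≫ₗ e3 ≪≫ₗ e2⟩

end stepB

section stepA
variable {R : Type} [CommRing R] {Q : Type} [AddCommGroup Q] [Module R⟦X⟧ Q] [Module R Q] [IsScalarTower R R⟦X⟧ Q]
  (π : Localization.Away (X : R⟦X⟧) →ₗ[R⟦X⟧] Q) (hπ : Function.Surjective π)
  (hker : LinearMap.ker π = LinearMap.range (Algebra.linearMap R⟦X⟧ (Localization.Away (X : R⟦X⟧))))

/-- the inverse of `X` -/
noncomputable def xi : Localization.Away (X : R⟦X⟧) := IsLocalization.Away.invSelf (X : R⟦X⟧)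

lemma X_xi : algebraMap R⟦X⟧ (Localization.Away (X : R⟦X⟧)) X * xi = 1 := IsLocalization.Away.mul_invSelf _

lemma X_smul_xi (i : ℕ) : (X : R⟦X⟧) • (xi ^ (i+1) : Localization.Away (X : R⟦X⟧)) = xi ^ i := by
  rw [Algebra.smul_def, pow_succ', ← mul_assoc, X_xi, one_mul]

lemma loc_inj : Function.Injective (algebraMap R⟦X⟧ (Localization.Away (X : R⟦X⟧))) := by
  apply IsLocalization.injective (M := Submonoid.powers (X : R⟦X⟧))
  rw [Submonoid.powers_le, mem_nonZeroDivisors_iff_right]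
  intro s hs
  ext n
  have := congrArg (coeff (n+1)) hs
  rwa [coeff_succ_mul_X] at this

lemma loc_rep (x : Localization.Away (X : R⟦X⟧)) : ∃ (k : ℕ) (s : R⟦X⟧), x = s • xi ^ k := by
  obtain ⟨k, s, h⟩ := IsLocalization.Away.surj (X : R⟦X⟧) x
  refine ⟨k, s, ?_⟩
  rw [Algebra.smul_def, ← h, mul_assoc, ← mul_pow, X_xi, one_pow, mul_one]

include hker hπ in
theorem exists_basis : ∃ b : Module.Basis ℕ R Q, QB b := by
  let q : ℕ → Q := fun i => π (xi ^ (i+1))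
  have hz : ∀ s : R⟦X⟧, π (algebraMap _ _ s) = 0 := fun s => by
    have : algebraMap R⟦X⟧ (Localization.Away (X : R⟦X⟧)) s ∈ LinearMap.ker π := by
      rw [hker]
      exact ⟨s, rfl⟩
    exact this
  have h0 : (X : R⟦X⟧) • q 0 = 0 := by
    simp only [q]
    rw [← map_smul, X_smul_xi, pow_zero, ← map_one (algebraMap R⟦X⟧ _), hz]
  have h1 : ∀ i, (X : R⟦X⟧) • q (i+1) = q i := fun i => by
    simp only [q]
    rw [← map_smul, X_smul_xi]
  have hpow : ∀ k i, (X : R⟦X⟧) ^ k • q (i + k) = q i := by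
    intro k
    induction k with
    | zero => intro i; simp
    | succ k ih => intro i; rw [pow_succ, mul_smul, ← add_assoc, h1, ih]
  have hpow0 : ∀ k i, i < k → (X : R⟦X⟧) ^ k • q i = 0 := by
    intro k i hik
    obtain ⟨d, rfl⟩ := Nat.exists_eq_add_of_lt hik
    have := hpow i 0
    rw [zero_add] at this
    rw [show i + d + 1 = d + 1 + i by omega, pow_add, mul_smul, this, pow_succ, mul_smul, h0, smul_zero]
  have hr : ∀ r : R, r • q 0 = 0 → r = 0 := by
    intro r hr
    rw [← algebraMap_smul R⟦X⟧ r (q 0)] at hr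
    simp only [q] at hr
    rw [← map_smul, ← LinearMap.mem_ker, hker] at hr
    obtain ⟨s, hs⟩ := hr
    rw [Algebra.linearMap_apply] at hs
    have h2 : algebraMap R⟦X⟧ (Localization.Away (X : R⟦X⟧)) (X * s) = algebraMap _ _ (algebraMap R R⟦X⟧ r) := by
      rw [map_mul, hs, Algebra.smul_def, zero_add, pow_one, mul_left_comm, X_xi, mul_one]
    have h3 := congrArg (coeff 0) (loc_inj h2)
    rw [coeff_zero_X_mul] at h3
    simpa using h3.symm
  have li : LinearIndependent R q := by
    rw [linearIndependent_iff]
    intro l hl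
    by_contra hne
    have hs : l.support.Nonempty := Finsupp.support_nonempty_iff.2 hne
    let N := l.support.max' hs
    have hN : N ∈ l.support := l.support.max'_mem hs
    have h4 : (X : R⟦X⟧) ^ N • (Finsupp.linearCombination R q l) = l N • q 0 := by
      rw [Finsupp.linearCombination_apply, Finsupp.sum, Finset.smul_sum, Finset.sum_eq_single N]
      · rw [smul_comm]
        have := hpow N 0
        rw [zero_add] at this
        rw [this]
      · intro i hi hne
        rw [smul_comm, hpow0 N i (lt_of_le_of_ne (l.support.le_max' i hi) hne), smul_zero]
      · intro h; exact absurd hN h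
    rw [hl, smul_zero] at h4
    exact (Finsupp.mem_support_iff.1 hN) (hr _ h4.symm)
  have sp : ⊤ ≤ Submodule.span R (Set.range q) := by
    rintro y -
    obtain ⟨x, rfl⟩ := hπ y
    obtain ⟨k, s, rfl⟩ := loc_rep x
    induction k generalizing s with
    | zero =>
      rw [pow_zero, ← Algebra.algebraMap_eq_smul_one, hz]
      exact zero_mem _
    | succ k ih =>
      obtain ⟨s', hs'⟩ : ∃ s', s = algebraMap R R⟦X⟧ (constantCoeff s) + X * s' :=
        ⟨_, by rw [add_comm]; exact eq_X_mul_shift_add_const s⟩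
      rw [hs', add_smul, mul_comm, mul_smul, X_smul_xi, map_add]
      refine add_mem ?_ (ih s')
      rw [map_smul, algebraMap_smul]
      exact Submodule.smul_mem _ _ (Submodule.subset_span ⟨k, rfl⟩)
  refine ⟨Module.Basis.mk li sp, ?_, ?_⟩
  · rw [Module.Basis.mk_apply]
    exact h0
  · intro i
    rw [Module.Basis.mk_apply, Module.Basis.mk_apply]
    exact h1 i

include hker hπ in
theorem stepA (I : Ideal R) (M : Type) [AddCommGroup M] [Module R M] (j : ℕ) :
    Nonempty ((localCohomology (JJ I) j).obj (ModuleCat.of R⟦X⟧ (Q ⊗[R] M)) ≃ₗ[R⟦X⟧]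
      (localCohomology (JJ I) (j+1)).obj (ModuleCat.of R⟦X⟧ (R⟦X⟧ ⊗[R] M))) := by
  obtain ⟨b, -⟩ := exists_basis π hπ hker
  let ι := Algebra.linearMap R⟦X⟧ (Localization.Away (X : R⟦X⟧))
  let F : (R⟦X⟧ ⊗[R] M) →ₗ[R⟦X⟧] (Localization.Away (X : R⟦X⟧) ⊗[R] M) := AlgebraTensorModule.map ι LinearMap.id
  let G : (Localization.Away (X : R⟦X⟧) ⊗[R] M) →ₗ[R⟦X⟧] (Q ⊗[R] M) := AlgebraTensorModule.map π LinearMap.id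
  have hex0 : Function.Exact (ι.restrictScalars R) (π.restrictScalars R) := by
    intro x
    change π x = 0 ↔ _
    rw [← LinearMap.mem_ker, hker]
    rfl
  have hG : Function.Surjective G := LinearMap.rTensor_surjective (g := π.restrictScalars R) M hπ
  have hex : Function.Exact F G := rTensor_exact (f := ι.restrictScalars R) (g := π.restrictScalars R) M hex0 hπ
  have hF : Function.Injective F := by
    have : Module.Free R Q := Module.Free.of_basis b
    obtain ⟨l, hl⟩ := Module.projective_lifting_property (π.restrictScalars R) LinearMap.id hπ
    have h4 : Function.Injective (ι.restrictScalars R) ∧ ∃ l, (π.restrictScalars R) ∘ₗ l = LinearMap.id := ⟨loc_inj, l, hl⟩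
    have h5 : Function.Surjective (π.restrictScalars R) ∧ ∃ l, l ∘ₗ (ι.restrictScalars R) = LinearMap.id :=
      ((Function.Exact.split_tfae' hex0).out 0 1).1 h4
    obtain ⟨-, ρ, hρ⟩ := h5
    have h6 : Function.LeftInverse (ρ.rTensor M) F := by
      intro z
      change (ρ.rTensor M) ((ι.restrictScalars R).rTensor M z) = z
      rw [← LinearMap.comp_apply, ← LinearMap.rTensor_comp, hρ, LinearMap.rTensor_id, LinearMap.id_apply]
    exact h6.injective
  let T : ShortComplex (ModuleCat.{0} R⟦X⟧) := ShortComplex.mk (ModuleCat.ofHom F) (ModuleCat.ofHom G) (by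
    apply ModuleCat.hom_ext
    apply LinearMap.ext
    intro x
    exact hex.apply_apply_eq_zero x)
  have hT : T.ShortExact := by
    refine ShortComplex.ShortExact.mk' ?_ ?_ ?_
    · rw [ShortComplex.ShortExact.moduleCat_exact_iff_function_exact]
      exact hex
    · rw [ModuleCat.mono_iff_injective]
      exact hF
    · rw [ModuleCat.epi_iff_surjective]
      exact hG
  let v : (Localization.Away (X : R⟦X⟧) ⊗[R] M) →ₗ[R⟦X⟧] (Localization.Away (X : R⟦X⟧) ⊗[R] M) :=
    AlgebraTensorModule.map (LinearMap.mulLeft R⟦X⟧ xi) LinearMap.id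
  have hv0 : ∀ z, (X : R⟦X⟧) • v z = z := by
    intro z
    induction z with
    | zero => simp
    | add x y hx hy => rw [map_add, smul_add, hx, hy]
    | tmul x m =>
      change (X : R⟦X⟧) • ((xi * x) ⊗ₜ[R] m) = x ⊗ₜ m
      rw [TensorProduct.smul_tmul', Algebra.smul_def, ← mul_assoc, X_xi, one_mul]
  have hv : (X : R⟦X⟧) • (ModuleCat.ofHom v : T.X₂ ⟶ T.X₂) = 𝟙 T.X₂ :=
    ModuleCat.hom_ext (LinearMap.ext hv0)
  have hX : (X : R⟦X⟧) ∈ JJ I := le_sup_right (a := Ideal.map (algebraMap R R⟦X⟧) I) (Ideal.mem_span_singleton_self _)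
  exact lesS (JJ I) T hT j (vanish_inv (JJ I) T.X₂ X hX _ hv j) (vanish_inv (JJ I) T.X₂ X hX _ hv (j+1))

end stepA

end KLC

/-- Let `R = K⟦x₁,…,xₙ⟧`, `S = R⟦x⟧`, and `Q = S_x/S`.  For every ideal `I ⊆ R`, every
`R`-module `M` and every `j`, the Kashiwara functor satisfies
`G(H^j_I(M)) ≅ H^{j+1}_{(I,x)S}(M ⊗_R S)` as `S`-modules. -/
theorem kashiwara_localCohomology
    {K : Type} [Field K] (n : ℕ)
    (Q : Type) [AddCommGroup Q]
    [Module (PowerSeries (MvPowerSeries (Fin n) K)) Q]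
    [Module (MvPowerSeries (Fin n) K) Q]
    [IsScalarTower (MvPowerSeries (Fin n) K) (PowerSeries (MvPowerSeries (Fin n) K)) Q]
    (π : Localization.Away (X : PowerSeries (MvPowerSeries (Fin n) K))
      →ₗ[PowerSeries (MvPowerSeries (Fin n) K)] Q)
    (hπ : Function.Surjective π)
    (hker : LinearMap.ker π = LinearMap.range (Algebra.linearMap
      (PowerSeries (MvPowerSeries (Fin n) K))
      (Localization.Away (X : PowerSeries (MvPowerSeries (Fin n) K)))))
    (I : Ideal (MvPowerSeries (Fin n) K))
    (M : Type) [AddCommGroup M] [Module (MvPowerSeries (Fin n) K) M]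
    (j : ℕ) :
    Nonempty
      ((Q ⊗[MvPowerSeries (Fin n) K]
          ((localCohomology I j).obj (ModuleCat.of (MvPowerSeries (Fin n) K) M)))
        ≃ₗ[PowerSeries (MvPowerSeries (Fin n) K)]
      ((localCohomology
          (Ideal.map (algebraMap (MvPowerSeries (Fin n) K)
              (PowerSeries (MvPowerSeries (Fin n) K))) I ⊔
            Ideal.span {(X : PowerSeries (MvPowerSeries (Fin n) K))}) (j + 1)).obj
        (ModuleCat.of (PowerSeries (MvPowerSeries (Fin n) K))
          ((PowerSeries (MvPowerSeries (Fin n) K)) ⊗[MvPowerSeries (Fin n) K] M)))) := by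

  obtain ⟨b, hb⟩ := KLC.exists_basis π hπ hker
  obtain ⟨e1⟩ := KLC.stepB hb I j (ModuleCat.of _ M)
  obtain ⟨e2⟩ := KLC.stepA π hπ hker I M j
  exact ⟨e1 ≪≫ₗ e2⟩
end
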